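/- arXiv:math/0207142 — 11 statements merged into one kernel-verified Lean document; each statement's English description precedes it below -/
import Mathlib

section
/- Fix an integer r ≥ 1 and an integer k with 1 ≤ k < 2(2^r − 1). Let K_{r,k} = [2(k+1)π/(2^{r+1}−1), 2kπ/(2^r−1)] ∪ [2^{r+1}kπ/(2^r−1), 2^{r+2}(k+1)π/(2^{r+1}−1)]. Then the family {K_{r,k} + 2mπ : m ∈ ℤ} partitions ℝ up to null sets, and the family {2^j K_{r,k} : j ∈ ℤ} partitions (0,∞) up to null sets (so K_{r,k} is an H²-wavelet set). -/
open MeasureTheory Set Filter Topology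
open scoped ENNReal Real

noncomputable section

/-- A countable family of sets partitions `S` up to Lebesgue-null sets: the sets are
pairwise disjoint up to null sets and their union differs from `S` by a null set. -/
def PartitionUpToNull {ι : Type*} (A : ι → Set ℝ) (S : Set ℝ) : Prop :=
  (∀ i j : ι, i ≠ j → volume (A i ∩ A j) = 0) ∧
  volume (symmDiff (⋃ i, A i) S) = 0

theorem aux_partition (a b : ℤ → ℝ) (s : ℤ) (A : ℤ → Set ℝ) (S : Set ℝ)
    (hab : ∀ n, a n ≤ b n) (hba : ∀ n, b n ≤ a (n + 1))
    (hA : ∀ n, A n = Icc (a n) (b n) ∪ Icc (b (n + s)) (a (n + s + 1)))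
    (hcov : ∀ x ∈ S, ∃ n, a n ≤ x ∧ x < a (n + 1))
    (hS : ∀ n x, a n ≤ x → x ∈ S) : PartitionUpToNull A S := by
  have hmono : Monotone a := monotone_int_of_le_succ fun n => (hab n).trans (hba n)
  have key : ∀ x i j, a i < x → x < a (i + 1) → a j < x → x < a (j + 1) → i = j := by
    intro x i j h1 h2 h3 h4
    have h5 := hmono.reflect_lt (h1.trans h4)
    have h6 := hmono.reflect_lt (h3.trans h2)
    omega
  refine ⟨?_, ?_⟩
  · intro i j hij
    refine measure_mono_null ?_ (((countable_range a).union (countable_range b)).measure_zero volume)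
    rintro x ⟨hi, hj⟩
    by_contra hx
    have hxa : ∀ n, a n ≠ x := fun n h => hx (Or.inl ⟨n, h⟩)
    have hxb : ∀ n, b n ≠ x := fun n h => hx (Or.inr ⟨n, h⟩)
    have cell : ∀ n, x ∈ A n → (a n < x ∧ x < b n) ∨ (b (n + s) < x ∧ x < a (n + s + 1)) := by
      intro n hn
      rw [hA] at hn
      rcases hn with ⟨h1, h2⟩ | ⟨h1, h2⟩
      · exact Or.inl ⟨lt_of_le_of_ne h1 (hxa _), lt_of_le_of_ne h2 (hxb _).symm⟩
      · exact Or.inr ⟨lt_of_le_of_ne h1 (hxb _), lt_of_le_of_ne h2 (hxa _).symm⟩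
    rcases cell i hi with ⟨h1, h2⟩ | ⟨h1, h2⟩ <;> rcases cell j hj with ⟨h3, h4⟩ | ⟨h3, h4⟩
    · exact hij (key x i j h1 (h2.trans_le (hba _)) h3 (h4.trans_le (hba _)))
    · have := key x i (j + s) h1 (h2.trans_le (hba _)) ((hab _).trans_lt h3) h4
      rw [this] at h2
      exact lt_asymm h2 h3
    · have := key x (i + s) j ((hab _).trans_lt h1) h2 h3 (h4.trans_le (hba _))
      rw [this] at h1
      exact lt_asymm h1 h4
    · have := key x (i + s) (j + s) ((hab _).trans_lt h1) h2 ((hab _).trans_lt h3) h4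
      omega
  · have : (⋃ i, A i) = S := by
      ext x
      rw [mem_iUnion]
      constructor
      · rintro ⟨n, hn⟩
        rw [hA] at hn
        rcases hn with ⟨h1, h2⟩ | ⟨h1, h2⟩
        · exact hS n x h1
        · exact hS _ x ((hab _).trans h1)
      · intro hx
        obtain ⟨n, h1, h2⟩ := hcov x hx
        rcases le_total x (b n) with h | h
        · exact ⟨n, by rw [hA]; exact Or.inl ⟨h1, h⟩⟩
        · refine ⟨n - s, ?_⟩
          rw [hA, sub_add_cancel]
          exact Or.inr ⟨h, h2.le⟩
    rw [this, symmDiff_self]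
    simp

/-- For `r ≥ 1` and `1 ≤ k < 2(2^r - 1)`, the two-interval set
`K_{r,k} = [2(k+1)π/(2^{r+1}-1), 2kπ/(2^r-1)] ∪ [2^{r+1}kπ/(2^r-1), 2^{r+2}(k+1)π/(2^{r+1}-1)]`
is an `H²`-wavelet set: its `2πℤ`-translates partition `ℝ` and its dyadic dilates
partition `(0,∞)`, up to null sets. -/
theorem two_interval_h2_wavelet_set (r : ℕ) (hr : 1 ≤ r) (k : ℤ)
    (hk1 : 1 ≤ k) (hk2 : k < 2 * (2 ^ r - 1)) :
    PartitionUpToNull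
      (fun m : ℤ => (fun x => x + 2 * (m : ℝ) * π) ''
        (Icc (2 * ((k : ℝ) + 1) * π / (2 ^ (r + 1) - 1)) (2 * (k : ℝ) * π / (2 ^ r - 1)) ∪
         Icc (2 ^ (r + 1) * (k : ℝ) * π / (2 ^ r - 1))
             (2 ^ (r + 2) * ((k : ℝ) + 1) * π / (2 ^ (r + 1) - 1))))
      Set.univ ∧
    PartitionUpToNull
      (fun j : ℤ => (fun x => (2 : ℝ) ^ j * x) ''
        (Icc (2 * ((k : ℝ) + 1) * π / (2 ^ (r + 1) - 1)) (2 * (k : ℝ) * π / (2 ^ r - 1)) ∪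
         Icc (2 ^ (r + 1) * (k : ℝ) * π / (2 ^ r - 1))
             (2 ^ (r + 2) * ((k : ℝ) + 1) * π / (2 ^ (r + 1) - 1))))
      (Ioi 0) := by
  have hπ := Real.pi_pos
  have hkR : (1 : ℝ) ≤ k := by exact_mod_cast hk1
  have hk2R : (k : ℝ) < 2 * (2 ^ r - 1) := by exact_mod_cast hk2
  have hN : (2 : ℝ) ≤ 2 ^ r := by
    calc (2 : ℝ) = 2 ^ 1 := by norm_num
      _ ≤ 2 ^ r := pow_le_pow_right₀ (by norm_num) hr
  obtain ⟨N, hNdef⟩ : ∃ N : ℝ, N = 2 ^ r := ⟨_, rfl⟩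
  have e1 : (2 : ℝ) ^ (r + 1) = 2 * N := by rw [hNdef]; ring
  have e2 : (2 : ℝ) ^ (r + 2) = 4 * N := by rw [hNdef]; ring
  rw [e1, e2, ← hNdef]
  rw [← hNdef] at hk2R hN
  have p1 : 0 < N - 1 := by linarith
  have p2 : 0 < 2 * N - 1 := by linarith
  obtain ⟨a, ha⟩ : ∃ a : ℝ, a = 2 * ((k : ℝ) + 1) * π / (2 * N - 1) := ⟨_, rfl⟩
  obtain ⟨b, hb⟩ : ∃ b : ℝ, b = 2 * (k : ℝ) * π / (N - 1) := ⟨_, rfl⟩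
  have hc : 2 * N * (k : ℝ) * π / (N - 1) = N * b := by rw [hb]; ring
  have hd : 4 * N * ((k : ℝ) + 1) * π / (2 * N - 1) = 2 * N * a := by rw [ha]; ring
  have hc' : N * b = b + 2 * k * π := by rw [hb]; field_simp; ring
  have hd' : 2 * N * a = a + 2 * (k + 1) * π := by rw [ha]; field_simp; ring
  have hapos : 0 < a := by rw [ha]; positivity
  have hab : a ≤ b := by
    rw [ha, hb, div_le_div_iff₀ p2 p1]
    nlinarith [mul_nonneg hπ.le (by nlinarith : (0 : ℝ) ≤ k * N - N + 1)]
  have hb2 : b ≤ 2 * a := by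
    have : N * b ≤ N * (2 * a) := by
      rw [← hc, show N * (2 * a) = 2 * N * a by ring, ← hd, div_le_div_iff₀ p1 p2]
      nlinarith [mul_nonneg (mul_nonneg hπ.le (by linarith : (0 : ℝ) ≤ N)) (sub_nonneg.2 hk2R.le)]
    exact le_of_mul_le_mul_left this (by linarith)
  have hbp : b ≤ a + 2 * π := by
    have : N * b ≤ 2 * N * a := by nlinarith
    rw [hc', hd'] at this
    linarith
  rw [hc, hd, ← ha, ← hb]
  constructor
  · refine aux_partition (fun n => a + 2 * n * π) (fun n => b + 2 * n * π) k _ _ ?_ ?_ ?_ ?_ ?_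
    · intro n; linarith
    · intro n; push_cast; linarith
    · intro n
      simp only [image_union, image_add_const_Icc]
      rw [hc', hd']
      push_cast
      congr 2 <;> ring
    · intro x _
      refine ⟨⌊(x - a) / (2 * π)⌋, ?_, ?_⟩
      · have := Int.floor_le ((x - a) / (2 * π))
        rw [le_div_iff₀ (by positivity)] at this
        linarith
      · have := Int.lt_floor_add_one ((x - a) / (2 * π))
        rw [div_lt_iff₀ (by positivity)] at this
        push_cast
        linarith
    · intros; trivial
  · have hz : ∀ n : ℤ, (0 : ℝ) < 2 ^ n := fun n => zpow_pos (by norm_num) n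
    have hz1 : ∀ n : ℤ, (2 : ℝ) ^ (n + 1) = 2 ^ n * 2 := fun n => zpow_add_one₀ (by norm_num) n
    refine aux_partition (fun n => 2 ^ n * a) (fun n => 2 ^ n * b) r _ _ ?_ ?_ ?_ ?_ ?_
    · intro n; exact mul_le_mul_of_nonneg_left hab (hz n).le
    · intro n
      rw [hz1, mul_assoc]
      exact mul_le_mul_of_nonneg_left hb2 (hz n).le
    · intro n
      have hr' : (2 : ℝ) ^ (n + (r : ℤ)) = 2 ^ n * N := by
        rw [zpow_add₀ (by norm_num), zpow_natCast, hNdef]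
      simp only [image_union, image_mul_left_Icc' (hz n)]
      rw [hz1, hr']
      congr 2 <;> ring
    · intro x hx
      obtain ⟨n, h1, h2⟩ := exists_mem_Ico_zpow (div_pos hx hapos) (one_lt_two : (1 : ℝ) < 2)
      exact ⟨n, (le_div_iff₀ hapos).1 h1, (div_lt_iff₀ hapos).1 h2⟩
    · intro n x h
      exact (mul_pos (hz n) hapos).trans_le h
end
end

section
/- Fix an integer r ≥ 1 and let E_r = (2^{−1}I_r) ∪ I_r ∪ J_r ∪ (I_r + 2^{r+2}π). For almost every ξ ∈ 2^{−1}I_r: ξ + 2kπ ∈ E_r (k ∈ ℤ) if and only if k = 0 or k = 2^r, and 2^j ξ ∈ E_r (j ∈ ℤ) if and only if j = 0 or j = 1. -/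
open MeasureTheory Set Filter Topology
open scoped ENNReal Real

noncomputable section

/-- `t_r = 2^{r+1}π/(2^{r+1}-1)`. -/
def tPt (r : ℕ) : ℝ := 2 ^ (r + 1) * π / (2 ^ (r + 1) - 1)

/-- `I_r = [t_r, 2π]`. -/
def Ir (r : ℕ) : Set ℝ := Icc (tPt r) (2 * π)

/-- `J_r = [2^{r+1}π, 2^{r+1}t_r]`. -/
def Jr (r : ℕ) : Set ℝ := Icc (2 ^ (r + 1) * π) (2 ^ (r + 1) * tPt r)

/-- `A + c = {a + c : a ∈ A}`. -/
def shift (A : Set ℝ) (c : ℝ) : Set ℝ := (fun x => x + c) '' A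

/-- `c A = {c a : a ∈ A}`. -/
def scale (c : ℝ) (A : Set ℝ) : Set ℝ := (fun x => c * x) '' A

/-- `E_r = (2^{-1}I_r) ∪ I_r ∪ J_r ∪ (I_r + 2^{r+2}π)`, the support of `𝓕ψ_r`. -/
def Er (r : ℕ) : Set ℝ :=
  scale 2⁻¹ (Ir r) ∪ Ir r ∪ Jr r ∪ shift (Ir r) (2 ^ (r + 2) * π)

theorem int_small (m : ℤ) (h1 : -(2 * π) < 2 * (m : ℝ) * π) (h2 : 2 * (m : ℝ) * π < 2 * π) :
    m = 0 := by
  have hp := Real.pi_pos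
  have a : (-1 : ℝ) < m := by
    by_contra h
    push Not at h
    nlinarith
  have b : (m : ℝ) < 1 := by
    by_contra h
    push Not at h
    nlinarith
  have a' : (-1 : ℤ) < m := by exact_mod_cast a
  have b' : m < (1 : ℤ) := by exact_mod_cast b
  omega

theorem mem_Er (r : ℕ) (x : ℝ) : x ∈ Er r ↔
    (tPt r / 2 ≤ x ∧ x ≤ π) ∨ (tPt r ≤ x ∧ x ≤ 2 * π) ∨
    (2 * 2 ^ r * π ≤ x ∧ x ≤ 2 * 2 ^ r * tPt r) ∨
    (tPt r + 4 * 2 ^ r * π ≤ x ∧ x ≤ 2 * π + 4 * 2 ^ r * π) := by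
  have e1 : (2 : ℝ) ^ (r + 1) = 2 * 2 ^ r := by ring
  have e2 : (2 : ℝ) ^ (r + 2) = 4 * 2 ^ r := by ring
  simp only [Er, scale, shift, Ir, Jr, mem_union, mem_image, mem_Icc, e1, e2, or_assoc]
  refine or_congr ?_ (or_congr Iff.rfl (or_congr Iff.rfl ?_))
  · constructor
    · rintro ⟨y, ⟨h1, h2⟩, rfl⟩
      constructor <;> linarith
    · rintro ⟨h1, h2⟩
      exact ⟨2 * x, ⟨by linarith, by linarith⟩, by ring⟩
  · constructor
    · rintro ⟨y, ⟨h1, h2⟩, rfl⟩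
      constructor <;> linarith
    · rintro ⟨h1, h2⟩
      exact ⟨x - 4 * 2 ^ r * π, ⟨by linarith, by linarith⟩, by ring⟩

/-- For a.e. `ξ ∈ 2^{-1}I_r`: `ξ + 2kπ ∈ E_r` iff `k = 0` or `k = 2^r`, and `2^j ξ ∈ E_r` iff `j = 0` or `j = 1`. -/
theorem lemma_one_i (r : ℕ) (hr : 1 ≤ r) :
    ∀ᵐ ξ : ℝ, ξ ∈ scale 2⁻¹ (Ir r) →
      ((∀ k : ℤ, ξ + 2 * (k : ℝ) * π ∈ Er r ↔ (k = 0 ∨ k = 2 ^ r)) ∧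
       (∀ j : ℤ, (2 : ℝ) ^ j * ξ ∈ Er r ↔ (j = 0 ∨ j = 1))) := by
  have hp := Real.pi_pos
  have hM : (2 : ℝ) ≤ 2 ^ r := by
    calc (2 : ℝ) = 2 ^ 1 := by norm_num
      _ ≤ 2 ^ r := pow_le_pow_right₀ (by norm_num) hr
  have hT : tPt r * (2 * 2 ^ r - 1) = 2 * 2 ^ r * π := by
    have e1 : (2 : ℝ) ^ (r + 1) = 2 * 2 ^ r := by ring
    have : (2 * 2 ^ r - 1 : ℝ) ≠ 0 := by linarith
    rw [tPt, e1]
    field_simp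
  have hT1 : π < tPt r := by nlinarith
  have hT2 : tPt r < 2 * π := by nlinarith
  have hNT : 2 * 2 ^ r * tPt r = tPt r + 2 * 2 ^ r * π := by linarith
  have ae1 : ∀ᵐ ξ : ℝ, ξ ≠ tPt r / 2 := by
    simp [ae_iff]
  have ae2 : ∀ᵐ ξ : ℝ, ξ ≠ π := by
    simp [ae_iff]
  filter_upwards [ae1, ae2] with ξ n1 n2 hξ
  have hl : tPt r / 2 < ξ := by
    obtain ⟨y, ⟨h1, h2⟩, rfl⟩ := hξ
    refine lt_of_le_of_ne ?_ (Ne.symm n1)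
    change _ ≤ 2⁻¹ * y
    linarith
  have hu : ξ < π := by
    obtain ⟨y, ⟨h1, h2⟩, rfl⟩ := hξ
    refine lt_of_le_of_ne ?_ n2
    change 2⁻¹ * y ≤ _
    linarith
  clear hξ n1 n2 ae1 ae2
  constructor
  · intro k
    rw [mem_Er]
    constructor
    · rintro (⟨h1, h2⟩ | ⟨h1, h2⟩ | ⟨h1, h2⟩ | ⟨h1, h2⟩)
      · left
        apply int_small <;> linarith
      · left
        apply int_small <;> linarith
      · right
        have := int_small (k - 2 ^ r) (by push_cast; linarith) (by push_cast; linarith)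
        omega
      · exfalso
        have := int_small (k - 2 * 2 ^ r) (by push_cast; linarith) (by push_cast; linarith)
        have hk : k = 2 * 2 ^ r := by omega
        subst hk
        push_cast at h1
        linarith
    · rintro (rfl | rfl)
      · left
        push_cast
        constructor <;> linarith
      · right; right; left
        push_cast
        constructor <;> linarith
  · intro j
    rw [mem_Er]
    constructor
    · intro h
      by_contra hj
      push Not at hj
      rcases lt_or_ge j 0 with hneg | hpos
      · have hz : (2 : ℝ) ^ j ≤ 2⁻¹ := by
          have := zpow_le_zpow_right₀ (a := (2 : ℝ)) (by norm_num) (show j ≤ -1 by omega)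
          simpa using this
        have hx : (2 : ℝ) ^ j * ξ ≤ 2⁻¹ * ξ := by
          apply mul_le_mul_of_nonneg_right hz; linarith
        have hq : 0 < 2 ^ r * π := by positivity
        have hq2 : 2 * π ≤ 2 ^ r * π := by nlinarith
        rcases h with ⟨h1, h2⟩ | ⟨h1, h2⟩ | ⟨h1, h2⟩ | ⟨h1, h2⟩ <;> linarith
      · obtain ⟨n, rfl⟩ := Int.eq_ofNat_of_zero_le hpos
        have hn : 2 ≤ n := by omega
        simp only [zpow_natCast] at h
        have h4 : (4 : ℝ) ≤ 2 ^ n := by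
          calc (4 : ℝ) = 2 ^ 2 := by norm_num
            _ ≤ 2 ^ n := pow_le_pow_right₀ (by norm_num) hn
        have hlo : (2 : ℝ) ^ n * (tPt r / 2) < 2 ^ n * ξ :=
          mul_lt_mul_of_pos_left hl (by positivity)
        have hup : (2 : ℝ) ^ n * ξ < 2 ^ n * π :=
          mul_lt_mul_of_pos_left hu (by positivity)
        rcases h with ⟨h1, h2⟩ | ⟨h1, h2⟩ | ⟨h1, h2⟩ | ⟨h1, h2⟩
        · nlinarith
        · nlinarith
        · have hlt : (2 : ℝ) ^ (r + 1) < 2 ^ n := by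
            rw [pow_succ]
            by_contra hc
            push Not at hc
            nlinarith
          have hrn : r + 1 < n := (pow_lt_pow_iff_right₀ (by norm_num)).1 hlt
          have hge : (2 : ℝ) ^ (r + 2) ≤ 2 ^ n := pow_le_pow_right₀ (by norm_num) hrn
          rw [pow_add] at hge
          nlinarith
        · have hlt : (2 : ℝ) ^ (r + 2) < 2 ^ n := by
            rw [pow_add]
            by_contra hc
            push Not at hc
            nlinarith
          have hrn : r + 2 < n := (pow_lt_pow_iff_right₀ (by norm_num)).1 hlt
          have hge : (2 : ℝ) ^ (r + 3) ≤ 2 ^ n := pow_le_pow_right₀ (by norm_num) hrn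
          rw [pow_add] at hge
          nlinarith
    · rintro (rfl | rfl)
      · left
        simp only [zpow_zero, one_mul]
        constructor <;> linarith
      · right; left
        simp only [zpow_one]
        constructor <;> linarith
end
end

section
/- Fix an integer r ≥ 1 and let E_r = (2^{−1}I_r) ∪ I_r ∪ J_r ∪ (I_r + 2^{r+2}π). For almost every ξ ∈ 2^{−1}I_r + 2^{r+1}π: ξ + 2kπ ∈ E_r (k ∈ ℤ) if and only if k = 0 or k = −2^r, and 2^j ξ ∈ E_r (j ∈ ℤ) if and only if j = 0 or j = 1. -/
open MeasureTheory Set Filter Topology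
open scoped ENNReal Real

noncomputable section

lemma mem_Er_iff' (r : ℕ) (x : ℝ) : x ∈ Er r ↔
    (tPt r ≤ 2 * x ∧ 2 * x ≤ 2 * π) ∨ (tPt r ≤ x ∧ x ≤ 2 * π) ∨
    (2 * (2:ℝ) ^ r * π ≤ x ∧ x ≤ 2 * (2:ℝ) ^ r * tPt r) ∨
    (tPt r + 4 * (2:ℝ) ^ r * π ≤ x ∧ x ≤ 2 * π + 4 * (2:ℝ) ^ r * π) := by
  have e1 : (2:ℝ) ^ (r+1) = 2 * 2 ^ r := by ring
  have e2 : (2:ℝ) ^ (r+2) = 4 * 2 ^ r := by ring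
  have h1 : x ∈ scale 2⁻¹ (Ir r) ↔ (tPt r ≤ 2 * x ∧ 2 * x ≤ 2 * π) := by
    constructor
    · rintro ⟨y, ⟨h, h'⟩, rfl⟩
      constructor <;> dsimp only <;> linarith
    · rintro ⟨h, h'⟩
      exact ⟨2 * x, ⟨h, h'⟩, by dsimp only; ring⟩
  have h2 : x ∈ shift (Ir r) (2 ^ (r + 2) * π) ↔
      (tPt r + 4 * (2:ℝ) ^ r * π ≤ x ∧ x ≤ 2 * π + 4 * (2:ℝ) ^ r * π) := by
    rw [e2]
    constructor
    · rintro ⟨y, ⟨h, h'⟩, rfl⟩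
      constructor <;> dsimp only <;> linarith
    · rintro ⟨h, h'⟩
      exact ⟨x - 4 * 2 ^ r * π, ⟨by linarith, by linarith⟩, by dsimp only; ring⟩
  have h3 : x ∈ Jr r ↔ (2 * (2:ℝ) ^ r * π ≤ x ∧ x ≤ 2 * (2:ℝ) ^ r * tPt r) := by
    unfold Jr; rw [e1]; exact Iff.rfl
  have h4 : x ∈ Ir r ↔ (tPt r ≤ x ∧ x ≤ 2 * π) := Iff.rfl
  unfold Er
  rw [mem_union, mem_union, mem_union, h1, h2, h3, h4, or_assoc, or_assoc]

/-- For a.e. `ξ ∈ 2^{-1}I_r + 2^{r+1}π`: `ξ + 2kπ ∈ E_r` iff `k = 0` or `k = -2^r`, and `2^j ξ ∈ E_r` iff `j = 0` or `j = 1`. -/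
theorem lemma_one_iii (r : ℕ) (hr : 1 ≤ r) :
    ∀ᵐ ξ : ℝ, ξ ∈ shift (scale 2⁻¹ (Ir r)) (2 ^ (r + 1) * π) →
      ((∀ k : ℤ, ξ + 2 * (k : ℝ) * π ∈ Er r ↔ (k = 0 ∨ k = -(2 ^ r))) ∧
       (∀ j : ℤ, (2 : ℝ) ^ j * ξ ∈ Er r ↔ (j = 0 ∨ j = 1))) := by
  refine ae_of_all _ ?_
  rintro ξ ⟨_, ⟨b, ⟨hb1, hb2⟩, rfl⟩, rfl⟩
  dsimp only
  have hπ := Real.pi_pos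
  have hP : (2:ℝ) ≤ 2 ^ r := by
    calc (2:ℝ) = 2 ^ 1 := by norm_num
      _ ≤ 2 ^ r := pow_le_pow_right₀ (by norm_num) hr
  have e1 : (2:ℝ) ^ (r+1) = 2 * 2 ^ r := by ring
  have ht : 2 * (2:ℝ) ^ r * tPt r = tPt r + 2 * (2:ℝ) ^ r * π := by
    have h0 : (2 * (2:ℝ) ^ r - 1) ≠ 0 := by linarith
    unfold tPt
    rw [e1]
    field_simp
    ring
  obtain ⟨a, rfl⟩ : ∃ a, b = 2 * a := ⟨b / 2, by ring⟩
  have hzP : ((2 ^ r : ℤ) : ℝ) = (2:ℝ) ^ r := by push_cast; rfl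
  have hsplit : ∀ j : ℤ, (2:ℝ) ^ (j + (r:ℤ)) = 2 ^ j * 2 ^ r := fun j => by
    rw [zpow_add₀ (by norm_num), zpow_natCast]
  rw [e1]
  simp only [mem_Er_iff']
  rw [ht]
  generalize tPt r = t at *
  have hP' := hzP
  have ht1 : π < t := by
    by_contra h
    push Not at h
    nlinarith
  have ht2 : t < 2 * π := by
    by_contra h
    push Not at h
    nlinarith
  have hPπ : 2 * π ≤ 2 ^ r * π := by nlinarith
  constructor
  · intro k
    obtain ⟨m, rfl⟩ : ∃ m : ℤ, k = m - 2 ^ r := ⟨k + 2 ^ r, by ring⟩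
    have hx : 2⁻¹ * (2 * a) + 2 * (2:ℝ) ^ r * π + 2 * ((m - 2 ^ r : ℤ) : ℝ) * π
        = a + 2 * ((m:ℝ) * π) := by push_cast; ring
    rw [hx]
    have lo : ∀ n : ℤ, n ≤ m → (n:ℝ) * π ≤ m * π := fun n h =>
      mul_le_mul_of_nonneg_right (by exact_mod_cast h) hπ.le
    have hi : ∀ n : ℤ, m ≤ n → (m:ℝ) * π ≤ n * π := fun n h =>
      mul_le_mul_of_nonneg_right (by exact_mod_cast h) hπ.le
    constructor
    · rintro (⟨h, h'⟩ | ⟨h, h'⟩ | ⟨h, h'⟩ | ⟨h, h'⟩)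
      · right
        rcases lt_trichotomy m 0 with hm | hm | hm
        · have := hi (-1) (by omega); push_cast at this; linarith
        · omega
        · have := lo 1 (by omega); push_cast at this; linarith
      · exfalso
        rcases le_or_gt m 0 with hm | hm
        · have := hi 0 (by omega); push_cast at this; linarith
        · have := lo 1 (by omega); push_cast at this; linarith
      · left
        rcases lt_trichotomy m (2 ^ r) with hm | hm | hm
        · have := hi (2 ^ r - 1) (by omega); push_cast at this; linarith
        · omega
        · have := lo (2 ^ r + 1) (by omega); push_cast at this; linarith
      · exfalso
        rcases le_or_gt m (2 * 2 ^ r) with hm | hm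
        · have := hi (2 * 2 ^ r) (by omega); push_cast at this; linarith
        · have := lo (2 * 2 ^ r + 1) (by omega); push_cast at this; linarith
    · rintro (h | h)
      · have : m = 2 ^ r := by omega
        subst this
        right; right; left
        push_cast
        constructor <;> linarith
      · have : m = 0 := by omega
        subst this
        left
        push_cast
        constructor <;> linarith
  · intro j
    have hxi : 2⁻¹ * (2 * a) + 2 * (2:ℝ) ^ r * π = a + 2 * (2 ^ r * π) := by ring
    rw [hxi]
    have hx0 : (0:ℝ) < 2 ^ j := by positivity
    have hs := hsplit j
    have mono : ∀ m n : ℤ, m ≤ n → (2:ℝ) ^ m ≤ 2 ^ n := fun m n h =>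
      zpow_le_zpow_right₀ (by norm_num) h
    constructor
    · intro H
      by_contra hj
      rcases le_or_gt 2 j with h2 | h2
      · have h4 := mono 2 j h2
        have h4' : (2:ℝ) ^ (2:ℤ) = 4 := by norm_num
        rw [h4'] at h4
        have : 4 * (a + 2 * (2 ^ r * π)) ≤ 2 ^ j * (a + 2 * (2 ^ r * π)) :=
          mul_le_mul_of_nonneg_right h4 (by linarith)
        rcases H with ⟨h, h'⟩ | ⟨h, h'⟩ | ⟨h, h'⟩ | ⟨h, h'⟩ <;> linarith
      have hjneg : j ≤ -1 := by omega
      have hup := mono j (-1) hjneg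
      have hh : (2:ℝ) ^ (-1:ℤ) = 1 / 2 := by norm_num
      rw [hh] at hup
      have hup' : 2 ^ j * (a + 2 * (2 ^ r * π)) ≤ 1 / 2 * (a + 2 * (2 ^ r * π)) :=
        mul_le_mul_of_nonneg_right hup (by linarith)
      have key : ∀ c : ℝ, (2:ℝ) ^ j * (a + 2 * (2 ^ r * π)) = 2 ^ j * a + 2 * (2 ^ (j + (r:ℤ)) * π) := by
        intro _; rw [hs]; ring
      have hja : 0 < (2:ℝ) ^ j * a := mul_pos hx0 (by linarith)
      have hxt : (2:ℝ) ^ j * (a + 2 * (2 ^ r * π)) < 2 ^ j * (2 * 2 ^ r * t) := by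
        apply mul_lt_mul_of_pos_left _ hx0
        linarith
      have hxt' : (2:ℝ) ^ j * (2 * 2 ^ r * t) = 2 * (2 ^ (j + (r:ℤ)) * t) := by
        rw [hs]; ring
      rcases lt_trichotomy (j + (r:ℤ)) (-1) with hc | hc | hc
      · have := mono _ (-2) (show j + (r:ℤ) ≤ -2 by omega)
        have h4 : (2:ℝ) ^ (-2:ℤ) = 1 / 4 := by norm_num
        rw [h4] at this
        have := mul_le_mul_of_nonneg_right this (by linarith : (0:ℝ) ≤ t)
        rcases H with ⟨h, h'⟩ | ⟨h, h'⟩ | ⟨h, h'⟩ | ⟨h, h'⟩ <;> linarith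
      · have k0 := key 0
        rw [hc, hh] at k0 hxt'
        rcases H with ⟨h, h'⟩ | ⟨h, h'⟩ | ⟨h, h'⟩ | ⟨h, h'⟩ <;> linarith
      · have := mono 0 _ (show 0 ≤ j + (r:ℤ) by omega)
        rw [zpow_zero] at this
        have := mul_le_mul_of_nonneg_right this hπ.le
        have k0 := key 0
        rcases H with ⟨h, h'⟩ | ⟨h, h'⟩ | ⟨h, h'⟩ | ⟨h, h'⟩ <;> linarith
    · rintro (rfl | rfl)
      · right; right; left
        rw [zpow_zero]
        constructor <;> linarith
      · right; right; right
        rw [zpow_one]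
        constructor <;> linarith
end
end

section
/- Fix an integer r ≥ 1 and let E_r = (2^{−1}I_r) ∪ I_r ∪ J_r ∪ (I_r + 2^{r+2}π). For almost every ξ ∈ J_r \ (2^{−1}I_r + 2^{r+1}π): ξ + 2kπ ∈ E_r (k ∈ ℤ) if and only if k = 0, and 2^j ξ ∈ E_r (j ∈ ℤ) if and only if j = 0. -/
open MeasureTheory Set Filter Topology
open scoped ENNReal Real

noncomputable section

theorem aux_tri (m : ℤ) : m = 0 ∨ (1 : ℝ) ≤ m ∨ (m : ℝ) ≤ -1 := by
  rcases lt_trichotomy m 0 with h | h | h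
  · right; right; exact_mod_cast (by omega : m ≤ -1)
  · left; exact h
  · right; left; exact_mod_cast (by omega : 1 ≤ m)

theorem aux_zp (m : ℤ) : (m = 0 ∧ (2:ℝ) ^ m = 1) ∨ (m = 1 ∧ (2:ℝ) ^ m = 2) ∨
    (4 : ℝ) ≤ 2 ^ m ∨ (0 < (2:ℝ) ^ m ∧ (2 : ℝ) ^ m ≤ 1 / 2) := by
  by_cases h0 : m = 0
  · left; simp [h0]
  by_cases h1 : m = 1
  · right; left; simp [h1]
  rcases lt_or_gt_of_ne h0 with h | h
  · right; right; right
    refine ⟨by positivity, ?_⟩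
    have := zpow_le_zpow_right₀ (a := (2:ℝ)) (by norm_num) (show m ≤ -1 by omega)
    norm_num at this ⊢
    exact this
  · right; right; left
    have := zpow_le_zpow_right₀ (a := (2:ℝ)) (by norm_num) (show 2 ≤ m by omega)
    norm_num at this ⊢
    exact this

/-- Normalised membership. -/
def EE (N s z : ℝ) : Prop :=
  (s / 2 ≤ z ∧ z ≤ 1) ∨ (s ≤ z ∧ z ≤ 2) ∨ (N ≤ z ∧ z ≤ N + s) ∨ (2 * N + s ≤ z ∧ z ≤ 2 * N + 2)

theorem aux_k (M : ℤ) (N s x : ℝ) (hN : N = 2 * M) (h1 : 1 < s) (h2 : s < 2)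
    (hx1 : N < x) (hx2 : x < N + s) (hx : ¬ (N + s / 2 ≤ x ∧ x ≤ N + 1)) (k : ℤ) :
    EE N s (x + 2 * k) ↔ k = 0 := by
  constructor
  · rintro (⟨a, b⟩ | ⟨a, b⟩ | ⟨a, b⟩ | ⟨a, b⟩)
    · exfalso
      rcases aux_tri (k + M) with h | h | h
      · have h' : (k : ℝ) + M = 0 := by exact_mod_cast h
        exact hx ⟨by linarith, by linarith⟩
      · push_cast at h; linarith
      · push_cast at h; linarith
    · exfalso
      rcases aux_tri (k + M) with h | h | h
      · have h' : (k : ℝ) + M = 0 := by exact_mod_cast h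
        linarith
      · push_cast at h; linarith
      · push_cast at h; linarith
    · rcases aux_tri k with h | h | h
      · exact h
      · linarith
      · linarith
    · exfalso
      rcases aux_tri (k - M) with h | h | h
      · have h' : (k : ℝ) - M = 0 := by exact_mod_cast h
        linarith
      · push_cast at h; linarith
      · push_cast at h; linarith
  · rintro rfl
    right; right; left
    constructor <;> push_cast <;> linarith

theorem aux_j (p : ℕ) (N s x : ℝ) (hN : N = 2 ^ p) (hN4 : 4 ≤ N) (h1 : 1 < s) (h2 : s < 2)
    (hs : N * s = N + s)
    (hx1 : N < x) (hx2 : x < N + s) (hx : ¬ (N + s / 2 ≤ x ∧ x ≤ N + 1)) (j : ℤ) :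
    EE N s (2 ^ j * x) ↔ j = 0 := by
  have hN0 : 0 < N := by linarith
  obtain ⟨v, rfl⟩ : ∃ v, x = N * v := ⟨x / N, by field_simp⟩
  have hv1 : 1 < v := by nlinarith
  have hv2 : v < s := by nlinarith
  have key : (2:ℝ) ^ j * (N * v) = 2 ^ (j + p) * v := by
    rw [zpow_add₀ (by norm_num), hN, zpow_natCast]; ring
  constructor
  · rintro (⟨a, b⟩ | ⟨a, b⟩ | ⟨a, b⟩ | ⟨a, b⟩)
    · exfalso
      rw [key] at a b
      rcases aux_zp (j + p) with ⟨-, h⟩ | ⟨-, h⟩ | h | ⟨h0, h⟩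
      · rw [h] at a b; linarith
      · rw [h] at a b; linarith
      · nlinarith
      · nlinarith
    · exfalso
      rw [key] at a b
      rcases aux_zp (j + p) with ⟨-, h⟩ | ⟨-, h⟩ | h | ⟨h0, h⟩
      · rw [h] at a b; linarith
      · rw [h] at a b; linarith
      · nlinarith
      · nlinarith
    · rcases aux_zp j with ⟨h', h⟩ | ⟨-, h⟩ | h | ⟨h0, h⟩
      · exact h'
      · rw [h] at a b; linarith
      · nlinarith
      · nlinarith
    · exfalso
      rcases aux_zp j with ⟨h', h⟩ | ⟨-, h⟩ | h | ⟨h0, h⟩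
      · rw [h] at a b; linarith
      · rw [h] at a b; exact hx ⟨by linarith, by linarith⟩
      · nlinarith
      · nlinarith
  · rintro rfl
    right; right; left
    constructor <;> simp <;> linarith

theorem mem_shift' (A : Set ℝ) (c y : ℝ) : y ∈ shift A c ↔ y - c ∈ A := by
  constructor
  · rintro ⟨a, ha, rfl⟩; simpa using ha
  · intro h; exact ⟨_, h, by simp⟩

theorem mem_scale' (A : Set ℝ) (y : ℝ) : y ∈ scale 2⁻¹ A ↔ 2 * y ∈ A := by
  constructor
  · rintro ⟨a, ha, rfl⟩; simpa using ha
  · intro h; exact ⟨_, h, by simp⟩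

theorem aux_mul (a b : ℝ) : a * π ≤ b * π ↔ a ≤ b := mul_le_mul_iff_left₀ Real.pi_pos

theorem aux_Er (r : ℕ) (s z : ℝ) (ht : tPt r = s * π)
    (hs : (2:ℝ) ^ (r + 1) * s = 2 ^ (r + 1) + s) :
    z * π ∈ Er r ↔ EE (2 ^ (r + 1)) s z := by
  have hp : (2:ℝ) ^ (r + 2) = 2 * 2 ^ (r + 1) := by ring
  simp only [Er, mem_union, mem_shift', mem_scale', Ir, Jr, mem_Icc, ht, EE, hp, ← mul_assoc, hs,
    ← sub_mul, aux_mul, or_assoc]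
  generalize (2:ℝ) ^ (r + 1) = N
  refine or_congr (and_congr ?_ ?_) (or_congr Iff.rfl (or_congr Iff.rfl (and_congr ?_ ?_))) <;>
    constructor <;> intro h <;> linarith

/-- For a.e. `ξ ∈ J_r \ (2^{-1}I_r + 2^{r+1}π)`: `ξ + 2kπ ∈ E_r` iff `k = 0`, and `2^j ξ ∈ E_r` iff `j = 0`. -/
theorem lemma_one_iv (r : ℕ) (hr : 1 ≤ r) :
    ∀ᵐ ξ : ℝ, ξ ∈ Jr r \ shift (scale 2⁻¹ (Ir r)) (2 ^ (r + 1) * π) →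
      ((∀ k : ℤ, ξ + 2 * (k : ℝ) * π ∈ Er r ↔ (k = 0)) ∧
       (∀ j : ℤ, (2 : ℝ) ^ j * ξ ∈ Er r ↔ (j = 0))) := by
  have hN4 : (4:ℝ) ≤ 2 ^ (r + 1) := by
    have := pow_le_pow_right₀ (a := (2:ℝ)) (by norm_num) (show 2 ≤ r + 1 by omega)
    norm_num at this ⊢
    exact this
  obtain ⟨s, hsd⟩ : ∃ s : ℝ, s = 2 ^ (r + 1) / (2 ^ (r + 1) - 1) := ⟨_, rfl⟩
  have hne : (2:ℝ) ^ (r + 1) - 1 ≠ 0 := by linarith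
  have ht : tPt r = s * π := by rw [tPt, hsd]; ring
  have hs0 : s * (2 ^ (r + 1) - 1) = 2 ^ (r + 1) := by rw [hsd]; field_simp
  have hs : (2:ℝ) ^ (r + 1) * s = 2 ^ (r + 1) + s := by linarith
  have h1 : 1 < s := by nlinarith
  have h2 : s < 2 := by nlinarith
  have e1 : ∀ᵐ ξ : ℝ, ξ ≠ 2 ^ (r + 1) * π := Measure.ae_ne volume _
  have e2 : ∀ᵐ ξ : ℝ, ξ ≠ (2 ^ (r + 1) + s) * π := Measure.ae_ne volume _
  filter_upwards [e1, e2] with ξ n1 n2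
  obtain ⟨x, rfl⟩ : ∃ x, ξ = x * π := ⟨ξ / π, by field_simp⟩
  rintro ⟨hJ, hI⟩
  simp only [Jr, mem_shift', mem_scale', Ir, mem_Icc, ht, ← mul_assoc, hs, ← sub_mul, aux_mul]
    at hJ hI
  have hx1 : 2 ^ (r + 1) < x := lt_of_le_of_ne hJ.1 (fun h => n1 (by rw [h]))
  have hx2 : x < 2 ^ (r + 1) + s := lt_of_le_of_ne hJ.2 (fun h => n2 (by rw [h]))
  have hx : ¬ ((2:ℝ) ^ (r + 1) + s / 2 ≤ x ∧ x ≤ 2 ^ (r + 1) + 1) :=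
    fun h => hI ⟨by linarith [h.1], by linarith [h.2]⟩
  constructor
  · intro k
    rw [← add_mul, aux_Er r s _ ht hs]
    exact aux_k (2 ^ r) _ s x (by push_cast; ring) h1 h2 hx1 hx2 hx k
  · intro j
    rw [← mul_assoc, aux_Er r s _ ht hs]
    exact aux_j (r + 1) _ s x rfl hN4 h1 h2 hs hx1 hx2 hx j
end
end

section
/- Fix an integer r ≥ 1 and let g_r : ℝ → ℝ be the function with g_r = 1/√2 on I_r ∪ (2^{−1}I_r) ∪ (2^{−1}I_r + 2^{r+1}π), g_r = −1/√2 on I_r + 2^{r+2}π, g_r = 1 on J_r \ (2^{−1}I_r + 2^{r+1}π), and g_r = 0 elsewhere. Then for almost every ξ ∈ ℝ, ∑_{j∈ℤ} |g_r(2^j ξ)|² = 1 if ξ > 0 and = 0 if ξ ≤ 0. -/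
open MeasureTheory Set Filter Topology
open scoped ENNReal Real

noncomputable section

open Classical in
/-- The function equal to `1/√2` on `I_r ∪ (2^{-1}I_r) ∪ (2^{-1}I_r + 2^{r+1}π)`,
to `-1/√2` on `I_r + 2^{r+2}π`, to `1` on `J_r \ (2^{-1}I_r + 2^{r+1}π)`,
and to `0` elsewhere. -/
def waveletProfile (r : ℕ) : ℝ → ℝ := fun ξ =>
  if ξ ∈ Ir r ∪ scale 2⁻¹ (Ir r) ∪ shift (scale 2⁻¹ (Ir r)) (2 ^ (r + 1) * π) then
    1 / Real.sqrt 2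
  else if ξ ∈ shift (Ir r) (2 ^ (r + 2) * π) then -(1 / Real.sqrt 2)
  else if ξ ∈ Jr r \ shift (scale 2⁻¹ (Ir r)) (2 ^ (r + 1) * π) then 1
  else 0

theorem zpow_unique_aux {η : ℝ} (h1 : π < η) (h2 : η < 2 * π) (j m : ℤ)
    (h3 : (2:ℝ) ^ m * π ≤ (2:ℝ) ^ j * η) (h4 : (2:ℝ) ^ j * η ≤ (2:ℝ) ^ m * (2 * π)) : j = m := by
  have hp := Real.pi_pos
  have a : (2:ℝ) ^ j < (2:ℝ) ^ (m + 1) := by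
    rw [zpow_add_one₀ (by norm_num)]
    have hj : (0:ℝ) < 2 ^ j := by positivity
    have : (2:ℝ) ^ j * π < 2 ^ m * 2 * π := by nlinarith [mul_lt_mul_of_pos_left h1 hj]
    exact lt_of_mul_lt_mul_right this hp.le
  have b : (2:ℝ) ^ m < (2:ℝ) ^ (j + 1) := by
    rw [zpow_add_one₀ (by norm_num)]
    have hj : (0:ℝ) < 2 ^ j := by positivity
    have : (2:ℝ) ^ m * π < 2 ^ j * 2 * π := by nlinarith [mul_lt_mul_of_pos_left h2 hj]
    exact lt_of_mul_lt_mul_right this hp.le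
  rw [zpow_lt_zpow_iff_right₀ (by norm_num)] at a b
  omega

theorem mem_halfI (r : ℕ) (x : ℝ) : x ∈ scale 2⁻¹ (Ir r) ↔ tPt r ≤ 2 * x ∧ 2 * x ≤ 2 * π := by
  unfold scale Ir
  constructor
  · rintro ⟨y, ⟨h1, h2⟩, rfl⟩
    constructor <;> simp only <;> linarith
  · rintro ⟨h1, h2⟩
    exact ⟨2 * x, ⟨h1, h2⟩, by simp⟩

theorem mem_K (r : ℕ) (x c : ℝ) : x ∈ shift (scale 2⁻¹ (Ir r)) c ↔
    tPt r ≤ 2 * (x - c) ∧ 2 * (x - c) ≤ 2 * π := by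
  rw [← mem_halfI]
  unfold shift
  constructor
  · rintro ⟨y, h, rfl⟩
    simpa using h
  · intro h
    exact ⟨x - c, h, by simp⟩

theorem mem_L (r : ℕ) (x c : ℝ) : x ∈ shift (Ir r) c ↔
    tPt r ≤ x - c ∧ x - c ≤ 2 * π := by
  unfold shift Ir
  constructor
  · rintro ⟨y, h, rfl⟩
    simpa using h
  · intro h
    exact ⟨x - c, h, by simp⟩

theorem tPt_facts (r : ℕ) (hr : 1 ≤ r) : (4:ℝ) ≤ 2 ^ (r + 1) ∧ π < tPt r ∧ tPt r < 2 * π ∧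
    2 ^ (r + 1) * tPt r = 2 ^ (r + 1) * π + tPt r := by
  have hp := Real.pi_pos
  have h4 : (4:ℝ) ≤ 2 ^ (r + 1) := by
    calc (4:ℝ) = 2 ^ 2 := by norm_num
      _ ≤ 2 ^ (r + 1) := pow_le_pow_right₀ (by norm_num) (by omega)
  refine ⟨h4, ?_, ?_, ?_⟩
  · unfold tPt
    rw [lt_div_iff₀ (by linarith)]; nlinarith
  · unfold tPt
    rw [div_lt_iff₀ (by linarith)]; nlinarith
  · have : tPt r * (2 ^ (r + 1) - 1) = 2 ^ (r + 1) * π := by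
      unfold tPt
      rw [div_mul_cancel₀]; linarith
    linarith

theorem profile_sq (r : ℕ) (hr : 1 ≤ r) {η : ℝ} (h1 : π < η) (h2 : η < 2 * π)
    (ht : η ≠ tPt r) :
    ∃ a b : ℤ, ∃ u v : ℝ, a ≠ b ∧ 0 ≤ u ∧ 0 ≤ v ∧ u + v = 1 ∧ ∀ j : ℤ,
      (waveletProfile r ((2:ℝ) ^ j * η)) ^ 2 = if j = a then u else if j = b then v else 0 := by
  obtain ⟨hN, t1, t2, t3⟩ := tPt_facts r hr
  have hp := Real.pi_pos
  have key := zpow_unique_aux h1 h2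
  have e2 : (2:ℝ) ^ (r + 2) = 2 * 2 ^ (r + 1) := by ring
  have z1 : (2:ℝ) ^ ((r:ℤ) + 1) = 2 ^ (r + 1) := by exact_mod_cast zpow_natCast (2:ℝ) (r + 1)
  have z2 : (2:ℝ) ^ ((r:ℤ) + 2) = 2 * 2 ^ (r + 1) := by
    rw [← e2]; exact_mod_cast zpow_natCast (2:ℝ) (r + 2)
  have zm : (2:ℝ) ^ (-1:ℤ) = 1 / 2 := by norm_num
  have z0 : (2:ℝ) ^ (0:ℤ) = 1 := by norm_num
  set N : ℝ := 2 ^ (r + 1) with hNdef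
  set t := tPt r with htdef
  have s1 : (1 / Real.sqrt 2) ^ 2 = 1 / 2 := by
    rw [div_pow, Real.sq_sqrt (by norm_num)]; norm_num
  have s2 : (-(1 / Real.sqrt 2)) ^ 2 = 1 / 2 := by rw [neg_sq, s1]
  have A : ∀ j : ℤ, (2:ℝ) ^ j * η ∈ Ir r ↔ j = 0 ∧ t ≤ η := by
    intro j
    simp only [Ir, mem_Icc]
    constructor
    · rintro ⟨p, q⟩
      have : j = 0 := key j 0 (by rw [z0]; linarith) (by rw [z0]; linarith)
      subst this; rw [z0] at p; exact ⟨rfl, by linarith⟩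
    · rintro ⟨rfl, p⟩
      rw [z0]; constructor <;> linarith
  have B : ∀ j : ℤ, (2:ℝ) ^ j * η ∈ scale 2⁻¹ (Ir r) ↔ j = -1 ∧ t ≤ η := by
    intro j
    rw [mem_halfI]
    constructor
    · rintro ⟨p, q⟩
      have : j = -1 := key j (-1) (by rw [zm]; linarith) (by rw [zm]; linarith)
      subst this; rw [zm] at p; exact ⟨rfl, by linarith⟩
    · rintro ⟨rfl, p⟩
      rw [zm]; constructor <;> linarith
  have NP : 4 * π ≤ N * π := by nlinarith
  have C : ∀ j : ℤ, (2:ℝ) ^ j * η ∈ shift (scale 2⁻¹ (Ir r)) (N * π) ↔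
      j = r + 1 ∧ (t ≤ 2 * (N * η - N * π) ∧ N * η - N * π ≤ π) := by
    intro j
    rw [mem_K]
    constructor
    · rintro ⟨p, q⟩
      have : j = r + 1 := key j (r + 1) (by rw [z1]; linarith) (by rw [z1]; linarith)
      subst this; rw [z1] at p q; exact ⟨rfl, by linarith, by linarith⟩
    · rintro ⟨rfl, p, q⟩
      rw [z1]; constructor <;> linarith
  have D : ∀ j : ℤ, (2:ℝ) ^ j * η ∈ shift (Ir r) (2 ^ (r + 2) * π) ↔
      j = r + 2 ∧ (t ≤ 2 * (N * η - N * π) ∧ N * η - N * π ≤ π) := by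
    intro j
    rw [mem_L, e2]
    constructor
    · rintro ⟨p, q⟩
      have : j = r + 2 := key j (r + 2) (by rw [z2]; linarith) (by rw [z2]; linarith)
      subst this; rw [z2] at p q; exact ⟨rfl, by linarith, by linarith⟩
    · rintro ⟨rfl, p, q⟩
      rw [z2]; constructor <;> linarith
  have E : ∀ j : ℤ, (2:ℝ) ^ j * η ∈ Jr r ↔ j = r + 1 ∧ η ≤ t := by
    intro j
    simp only [Jr, mem_Icc]
    rw [← hNdef, ← htdef]
    constructor
    · rintro ⟨p, q⟩
      have : j = r + 1 := key j (r + 1) (by rw [z1]; linarith) (by rw [z1]; linarith)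
      subst this; rw [z1] at p q
      exact ⟨rfl, le_of_mul_le_mul_left q (by linarith)⟩
    · rintro ⟨rfl, p⟩
      rw [z1]; constructor <;> nlinarith
  have F : ∀ j : ℤ, (waveletProfile r ((2:ℝ) ^ j * η)) ^ 2 =
      if ((j = 0 ∧ t ≤ η) ∨ (j = -1 ∧ t ≤ η)) ∨
        (j = r + 1 ∧ (t ≤ 2 * (N * η - N * π) ∧ N * η - N * π ≤ π)) then 1 / 2
      else if j = r + 2 ∧ (t ≤ 2 * (N * η - N * π) ∧ N * η - N * π ≤ π) then 1 / 2
      else if j = r + 1 ∧ η ≤ t then 1 else 0 := by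
    intro j
    unfold waveletProfile
    simp only [mem_union, Set.mem_sdiff, ← hNdef, A, B, C, D, E]
    clear A B C D E key
    split_ifs <;> first | exact s1 | exact s2 | (norm_num; done) | (exfalso; tauto)
  by_cases P : t ≤ η
  · have Pn : ¬ η ≤ t := fun h => ht (le_antisymm h P)
    have Q : ¬ (t ≤ 2 * (N * η - N * π) ∧ N * η - N * π ≤ π) := by
      rintro ⟨_, q⟩
      nlinarith
    refine ⟨0, -1, 1 / 2, 1 / 2, by norm_num, by norm_num, by norm_num, by norm_num, fun j => ?_⟩
    rw [F j]
    simp only [P, Pn, Q, and_true, and_false, or_false, if_false]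
    split_ifs <;> first | rfl | (exfalso; tauto)
  · have Pn : η ≤ t := (not_le.mp P).le
    by_cases Q : (t ≤ 2 * (N * η - N * π) ∧ N * η - N * π ≤ π)
    · refine ⟨r + 1, r + 2, 1 / 2, 1 / 2, by omega, by norm_num, by norm_num, by norm_num,
        fun j => ?_⟩
      rw [F j]
      simp only [P, Pn, Q, and_true, and_false, or_false, false_or]
      split_ifs <;> first | rfl | (exfalso; tauto)
    · refine ⟨r + 1, r + 2, 1, 0, by omega, by norm_num, by norm_num, by norm_num,
        fun j => ?_⟩
      rw [F j]
      simp only [P, Pn, Q, and_true, and_false, or_false, if_false]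
      split_ifs <;> rfl

theorem profile_nonpos (r : ℕ) (hr : 1 ≤ r) {x : ℝ} (hx : x ≤ 0) : waveletProfile r x = 0 := by
  obtain ⟨hN, t1, t2, t3⟩ := tPt_facts r hr
  have hp := Real.pi_pos
  have NP : 4 * π ≤ 2 ^ (r + 1) * π := by nlinarith
  have e2 : (2:ℝ) ^ (r + 2) = 2 * 2 ^ (r + 1) := by ring
  unfold waveletProfile
  rw [if_neg, if_neg, if_neg]
  · rintro ⟨⟨a, _⟩, _⟩; linarith
  · rw [mem_L, e2]; rintro ⟨a, _⟩; linarith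
  · rw [mem_union, mem_union, mem_halfI, mem_K]
    rintro ((⟨a, _⟩ | ⟨a, _⟩) | ⟨a, _⟩) <;> linarith

/-- For a.e. `ξ ∈ ℝ`, `∑_{j∈ℤ} |g_r(2^jξ)|²` equals `1` if `ξ > 0`
and `0` if `ξ ≤ 0`. -/
theorem sum_of_squares_over_dilates (r : ℕ) (hr : 1 ≤ r) :
    ∀ᵐ ξ : ℝ,
      (∑' j : ℤ, ENNReal.ofReal ((waveletProfile r ((2 : ℝ) ^ j * ξ)) ^ 2))
        = if 0 < ξ then 1 else 0 := by
  have hp := Real.pi_pos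
  have hc : (⋃ k : ℤ, ({(2:ℝ) ^ k * π, (2:ℝ) ^ k * tPt r} : Set ℝ)).Countable :=
    countable_iUnion fun k => (Set.toFinite _).countable
  filter_upwards [hc.ae_notMem volume] with ξ hξ
  simp only [mem_iUnion, mem_insert_iff, mem_singleton_iff, not_exists, not_or] at hξ
  by_cases h0 : 0 < ξ
  · rw [if_pos h0]
    obtain ⟨n, n1, n2⟩ := exists_mem_Ico_zpow (div_pos h0 hp) (one_lt_two (α := ℝ))
    rw [le_div_iff₀ hp] at n1
    rw [div_lt_iff₀ hp, zpow_add_one₀ (by norm_num)] at n2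
    have hn : (0:ℝ) < 2 ^ n := by positivity
    obtain ⟨η, rfl⟩ : ∃ η, ξ = 2 ^ n * η := ⟨ξ / 2 ^ n, by field_simp⟩
    have h1 : π < η := by
      refine lt_of_le_of_ne (le_of_mul_le_mul_left n1 hn) ?_
      rintro rfl
      exact (hξ n).1 rfl
    have h2 : η < 2 * π := by
      refine lt_of_mul_lt_mul_left (a := (2:ℝ) ^ n) ?_ hn.le
      linarith
    have h3 : η ≠ tPt r := by
      rintro rfl
      exact (hξ n).2 rfl
    obtain ⟨a, b, u, v, hab, hu, hv, huv, H⟩ := profile_sq r hr h1 h2 h3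
    have e : ∀ j : ℤ, (2:ℝ) ^ j * (2 ^ n * η) = 2 ^ (Equiv.addRight n j) * η := by
      intro j
      rw [Equiv.coe_addRight, zpow_add₀ (by norm_num), mul_assoc]
    simp_rw [e]
    rw [(Equiv.addRight n).tsum_eq
      (fun j : ℤ => ENNReal.ofReal ((waveletProfile r ((2 : ℝ) ^ j * η)) ^ 2))]
    simp_rw [H]
    rw [tsum_eq_sum (s := {a, b}), Finset.sum_pair hab]
    · rw [if_pos rfl, if_neg hab.symm, if_pos rfl, ← ENNReal.ofReal_add hu hv, huv,
        ENNReal.ofReal_one]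
    · intro j hj
      simp only [Finset.mem_insert, Finset.mem_singleton, not_or] at hj
      rw [if_neg hj.1, if_neg hj.2, ENNReal.ofReal_zero]
  · rw [if_neg h0]
    have : ∀ j : ℤ, waveletProfile r ((2:ℝ) ^ j * ξ) = 0 := fun j =>
      profile_nonpos r hr (mul_nonpos_of_nonneg_of_nonpos (by positivity) (not_lt.mp h0))
    simp [this]
end
end

section
/- Fix an integer r ≥ 1 and let g_r : ℝ → ℝ be the function with g_r = 1/√2 on I_r ∪ (2^{−1}I_r) ∪ (2^{−1}I_r + 2^{r+1}π), g_r = −1/√2 on I_r + 2^{r+2}π, g_r = 1 on J_r \ (2^{−1}I_r + 2^{r+1}π), and g_r = 0 elsewhere. Then for every odd integer q and almost every ξ ∈ ℝ, ∑_{j≥0} g_r(2^j ξ) · g_r(2^j(ξ + 2qπ)) = 0. -/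
open MeasureTheory Set Filter Topology
open scoped ENNReal Real

noncomputable section

lemma mem_shift_iff (A : Set ℝ) (c x : ℝ) : x ∈ shift A c ↔ x - c ∈ A := by
  unfold shift
  constructor
  · rintro ⟨a, ha, rfl⟩
    simpa using ha
  · intro h
    exact ⟨x - c, h, by simp⟩

lemma mem_scale_iff (A : Set ℝ) (x : ℝ) : x ∈ scale 2⁻¹ A ↔ 2 * x ∈ A := by
  unfold scale
  constructor
  · rintro ⟨a, ha, rfl⟩
    simpa using ha
  · intro h
    exact ⟨2 * x, h, by simp⟩

def tt (r : ℕ) : ℝ := 2 ^ (r + 1) / (2 ^ (r + 1) - 1)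

lemma four_le (r : ℕ) (hr : 1 ≤ r) : (4 : ℝ) ≤ 2 ^ (r + 1) := by
  have : (2 : ℝ) ^ 2 ≤ 2 ^ (r + 1) := pow_le_pow_right₀ (by norm_num) (by omega)
  linarith

lemma tPt_eq (r : ℕ) : tPt r = tt r * π := by
  unfold tPt tt; ring

lemma tt_mul (r : ℕ) (hr : 1 ≤ r) : 2 ^ (r + 1) * tt r = 2 ^ (r + 1) + tt r := by
  have h := four_le r hr
  have : (2 : ℝ) ^ (r + 1) - 1 ≠ 0 := by linarith
  unfold tt
  field_simp
  ring

lemma tt_bd (r : ℕ) (hr : 1 ≤ r) : 1 < tt r ∧ tt r ≤ 4 / 3 := by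
  have h := four_le r hr
  have h2 := tt_mul r hr
  constructor <;> nlinarith

lemma mem_Ir (r : ℕ) (u : ℝ) : u * π ∈ Ir r ↔ tt r ≤ u ∧ u ≤ 2 := by
  unfold Ir
  rw [mem_Icc, tPt_eq, mul_le_mul_iff_left₀ Real.pi_pos, mul_le_mul_iff_left₀ Real.pi_pos]

lemma mem_Jr (r : ℕ) (hr : 1 ≤ r) (u : ℝ) :
    u * π ∈ Jr r ↔ 2 ^ (r + 1) ≤ u ∧ u ≤ 2 ^ (r + 1) + tt r := by
  unfold Jr
  rw [mem_Icc, tPt_eq, ← mul_assoc, tt_mul r hr, mul_le_mul_iff_left₀ Real.pi_pos,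
    mul_le_mul_iff_left₀ Real.pi_pos]

lemma mem_A (r : ℕ) (u : ℝ) :
    u * π ∈ scale 2⁻¹ (Ir r) ↔ tt r ≤ 2 * u ∧ 2 * u ≤ 2 := by
  rw [mem_scale_iff, ← mul_assoc, mem_Ir]

lemma mem_C (r : ℕ) (u : ℝ) :
    u * π ∈ shift (scale 2⁻¹ (Ir r)) (2 ^ (r + 1) * π) ↔
      tt r ≤ 2 * (u - 2 ^ (r + 1)) ∧ 2 * (u - 2 ^ (r + 1)) ≤ 2 := by
  rw [mem_shift_iff, ← sub_mul, mem_A]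

lemma mem_D (r : ℕ) (u : ℝ) :
    u * π ∈ shift (Ir r) (2 ^ (r + 2) * π) ↔
      tt r ≤ u - 2 * 2 ^ (r + 1) ∧ u - 2 * 2 ^ (r + 1) ≤ 2 := by
  rw [mem_shift_iff, ← sub_mul, mem_Ir, pow_succ _ (r + 1), mul_comm _ (2 : ℝ)]

lemma g_supp (r : ℕ) (hr : 1 ≤ r) (u : ℝ) (h : waveletProfile r (u * π) ≠ 0) :
    (tt r ≤ 2 * u ∧ u ≤ 1) ∨ (tt r ≤ u ∧ u ≤ 2) ∨
    (2 ^ (r + 1) ≤ u ∧ u ≤ 2 ^ (r + 1) + tt r) ∨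
    (2 * 2 ^ (r + 1) + tt r ≤ u ∧ u ≤ 2 * 2 ^ (r + 1) + 2) := by
  obtain ⟨h1, h2⟩ := tt_bd r hr
  unfold waveletProfile at h
  simp only [mem_union, Set.mem_sdiff, mem_Ir, mem_A, mem_C, mem_D, mem_Jr r hr] at h
  split_ifs at h with a b c
  · rcases a with (a | a) | a
    · right; left; exact a
    · left; constructor <;> linarith [a.1, a.2]
    · right; right; left; constructor <;> linarith [a.1, a.2]
  · right; right; right; constructor <;> linarith [b.1, b.2]
  · right; right; left; exact c.1
  · exact absurd rfl h

lemma g_pos (r : ℕ) (u : ℝ) (h : (tt r ≤ 2 * u ∧ 2 * u ≤ 2) ∨ (tt r ≤ u ∧ u ≤ 2) ∨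
    (tt r ≤ 2 * (u - 2 ^ (r + 1)) ∧ 2 * (u - 2 ^ (r + 1)) ≤ 2)) :
    waveletProfile r (u * π) = 1 / Real.sqrt 2 := by
  unfold waveletProfile
  simp only [mem_union, mem_Ir, mem_A, mem_C]
  rw [if_pos]
  tauto

lemma g_neg (r : ℕ) (hr : 1 ≤ r) (u : ℝ)
    (h : tt r ≤ u - 2 * 2 ^ (r + 1) ∧ u - 2 * 2 ^ (r + 1) ≤ 2) :
    waveletProfile r (u * π) = -(1 / Real.sqrt 2) := by
  obtain ⟨h1, h2⟩ := tt_bd r hr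
  have h4 := four_le r hr
  unfold waveletProfile
  simp only [mem_union, mem_Ir, mem_A, mem_C, mem_D]
  rw [if_neg, if_pos h]
  rintro ((a | a) | a) <;> linarith [a.1, a.2, h.1, h.2]

lemma term_ne (r : ℕ) (hr : 1 ≤ r) (x : ℝ) (m : ℤ) (hm : 0 < m)
    (e1 : x ≠ tt r) (e2 : x ≠ 2) (e3 : x ≠ 2 ^ (r + 1)) (e4 : x ≠ 2 ^ (r + 1) + tt r)
    (h : waveletProfile r (x * π) * waveletProfile r ((x + 2 * m) * π) ≠ 0) :
    (m = 2 ^ r ∧ tt r ≤ 2 * x ∧ x ≤ 1) ∨ (m = 2 ^ (r + 1) ∧ tt r ≤ x ∧ x ≤ 2) := by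
  have hx := g_supp r hr _ (left_ne_zero_of_mul h)
  have hy := g_supp r hr _ (right_ne_zero_of_mul h)
  obtain ⟨h1, h2⟩ := tt_bd r hr
  have h4 := four_le r hr
  clear h
  have hN : (2 : ℝ) ^ (r + 1) = 2 * ((2 ^ r : ℤ) : ℝ) := by push_cast; ring
  have hN' : (2 : ℤ) ^ (r + 1) = 2 * 2 ^ r := by ring
  rw [hN']
  clear hN'
  rw [hN] at e3 e4 hx hy h4
  clear hN
  generalize (2 : ℤ) ^ r = M at *
  generalize tt r = t at *
  have hm' : (1 : ℝ) ≤ m := by exact_mod_cast hm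
  have hM : (2 : ℝ) ≤ M := by linarith
  have hMz : 2 ≤ M := by exact_mod_cast hM
  have cases : m ≤ M - 2 ∨ m = M - 1 ∨ m = M ∨ m = M + 1 ∨ (M + 2 ≤ m ∧ m ≤ 2 * M - 1) ∨
    m = 2 * M ∨ 2 * M + 1 ≤ m := by omega
  have C2 : ((m : ℝ) ≤ M - 2) ∨ (m : ℝ) = M - 1 ∨ (m = M ∧ (m : ℝ) = M) ∨ (m : ℝ) = M + 1 ∨
    ((M : ℝ) + 2 ≤ m ∧ (m : ℝ) ≤ 2 * M - 1) ∨
    (m = 2 * M ∧ (m : ℝ) = 2 * M) ∨ (2 * M + 1 : ℝ) ≤ m := by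
    rcases cases with c | c | c | c | c | c | c
    · left; exact_mod_cast c
    · right; left; exact_mod_cast c
    · right; right; left; exact ⟨c, by exact_mod_cast c⟩
    · right; right; right; left; exact_mod_cast c
    · right; right; right; right; left; exact ⟨by exact_mod_cast c.1, by exact_mod_cast c.2⟩
    · right; right; right; right; right; left; exact ⟨c, by exact_mod_cast c⟩
    · right; right; right; right; right; right; exact_mod_cast c
  rcases hx with ⟨a, b⟩ | ⟨a, b⟩ | ⟨a, b⟩ | ⟨a, b⟩
  · rcases hy with ⟨c, d⟩ | ⟨c, d⟩ | ⟨c, d⟩ | ⟨c, d⟩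
    · exfalso; linarith
    · exfalso; linarith
    · left
      rcases C2 with k | k | k | k | k | k | k
      · exfalso; linarith
      · exfalso; linarith
      · exact ⟨k.1, a, b⟩
      · exfalso; linarith
      · exfalso; linarith
      · exfalso; linarith
      · exfalso; linarith
    · exfalso
      rcases C2 with k | k | k | k | k | k | k <;> linarith
  · rcases hy with ⟨c, d⟩ | ⟨c, d⟩ | ⟨c, d⟩ | ⟨c, d⟩
    · exfalso; linarith
    · exfalso; linarith
    · exfalso
      rcases C2 with k | k | k | k | k | k | k
      · linarith
      · exact e2 (by linarith)
      · exact e1 (by linarith)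
      all_goals linarith
    · right
      rcases C2 with k | k | k | k | k | k | k
      · exfalso; linarith
      · exfalso; linarith
      · exfalso; linarith
      · exfalso; linarith
      · exfalso; linarith
      · exact ⟨k.1, a, b⟩
      · exfalso; linarith
  · exfalso
    rcases hy with ⟨c, d⟩ | ⟨c, d⟩ | ⟨c, d⟩ | ⟨c, d⟩
    · linarith
    · linarith
    · linarith
    · rcases C2 with k | k | k | k | k | k | k
      · linarith
      · linarith
      · exact e4 (by linarith)
      · exact e3 (by linarith)
      all_goals linarith
  · exfalso
    rcases hy with ⟨c, d⟩ | ⟨c, d⟩ | ⟨c, d⟩ | ⟨c, d⟩ <;> linarith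

lemma odd_pow_eq (q : ℤ) (hq : Odd q) (hp : 0 < q) (j s : ℕ) (h : 2 ^ j * q = 2 ^ s) :
    q = 1 ∧ j = s := by
  have hd : q ∣ 2 ^ s := ⟨2 ^ j, by rw [← h]; ring⟩
  have hc : IsCoprime q (2 ^ s) := by
    apply IsCoprime.pow_right
    rw [Int.isCoprime_iff_gcd_eq_one]
    exact Int.isCoprime_iff_gcd_eq_one.mp (Int.isCoprime_two_right.mpr hq)
  have hu : IsUnit q := hc.isUnit_of_dvd' dvd_rfl hd
  have h1 : q = 1 := by
    rcases Int.isUnit_iff.mp hu with h | h <;> omega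
  refine ⟨h1, ?_⟩
  rw [h1, mul_one] at h
  exact Int.pow_right_injective (le_refl 2) h

lemma pos_case (r : ℕ) (hr : 1 ≤ r) (q : ℤ) (hq : Odd q) (hp : 0 < q) (u : ℝ)
    (e : ∀ j : ℕ, (2 : ℝ) ^ j * u ≠ tt r ∧ (2 : ℝ) ^ j * u ≠ 2 ∧
      (2 : ℝ) ^ j * u ≠ 2 ^ (r + 1) ∧ (2 : ℝ) ^ j * u ≠ 2 ^ (r + 1) + tt r) :
    HasSum (fun j : ℕ =>
        waveletProfile r ((2 : ℝ) ^ j * u * π) *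
          waveletProfile r ((2 : ℝ) ^ j * (u + 2 * (q : ℝ)) * π)) 0 := by
  have key : ∀ j : ℕ, waveletProfile r ((2 : ℝ) ^ j * u * π) *
          waveletProfile r ((2 : ℝ) ^ j * (u + 2 * (q : ℝ)) * π) ≠ 0 →
      (q = 1 ∧ j = r ∧ tt r ≤ 2 ^ (r + 1) * u ∧ 2 ^ (r + 1) * u ≤ 2) ∨
      (q = 1 ∧ j = r + 1 ∧ tt r ≤ 2 ^ (r + 1) * u ∧ 2 ^ (r + 1) * u ≤ 2) := by
    intro j hj
    obtain ⟨e1, e2, e3, e4⟩ := e j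
    have := term_ne r hr (2 ^ j * u) (2 ^ j * q) (by positivity) e1 e2 e3 e4 (by
      convert hj using 4; push_cast; ring)
    rcases this with ⟨a, b, c⟩ | ⟨a, b, c⟩
    · obtain ⟨h1, rfl⟩ := odd_pow_eq q hq hp _ _ a
      left
      refine ⟨h1, rfl, ?_, ?_⟩ <;> rw [pow_succ] <;> linarith
    · obtain ⟨h1, rfl⟩ := odd_pow_eq q hq hp _ _ a
      right
      exact ⟨h1, rfl, b, c⟩
  by_cases hA : q = 1 ∧ tt r ≤ 2 ^ (r + 1) * u ∧ 2 ^ (r + 1) * u ≤ 2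
  · obtain ⟨rfl, a, b⟩ := hA
    have hs := hasSum_sum_of_ne_finset_zero (L := SummationFilter.unconditional ℕ) (f := fun j : ℕ =>
        waveletProfile r ((2 : ℝ) ^ j * u * π) *
          waveletProfile r ((2 : ℝ) ^ j * (u + 2 * ((1 : ℤ) : ℝ)) * π))
        (s := {r, r + 1}) (by
          intro j hj
          by_contra hne
          rcases key j hne with h | h <;> simp [h.2.1] at hj)
    rw [Finset.sum_pair (by omega)] at hs
    have p := pow_succ (2 : ℝ) r
    have p2 : (2 : ℝ) ^ (r + 1) * u = 2 * (2 ^ r * u) := by rw [p]; ring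
    rw [g_pos r (2 ^ r * u) (Or.inl (by constructor <;> linarith)),
      g_pos r (2 ^ r * (u + 2 * ((1 : ℤ) : ℝ)))
        (Or.inr (Or.inr (by push_cast; constructor <;> linarith))),
      g_pos r (2 ^ (r + 1) * u) (Or.inr (Or.inl ⟨a, b⟩)),
      g_neg r hr (2 ^ (r + 1) * (u + 2 * ((1 : ℤ) : ℝ)))
        (by push_cast; constructor <;> linarith)] at hs
    convert hs using 1
    ring
  · convert hasSum_zero using 1
    funext j
    by_contra hne
    rcases key j hne with h | h
    · exact hA ⟨h.1, h.2.2⟩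
    · exact hA ⟨h.1, h.2.2⟩

lemma ae_ne (c d : ℝ) (j : ℕ) : ∀ᵐ ξ : ℝ, (2 : ℝ) ^ j * (ξ / π + d) ≠ c := by
  have : {ξ : ℝ | ¬ ((2 : ℝ) ^ j * (ξ / π + d) ≠ c)} ⊆ {(c / 2 ^ j - d) * π} := by
    intro ξ h
    simp only [ne_eq, not_not, mem_ofPred_eq] at h
    rw [mem_singleton_iff, ← h]
    have := Real.pi_pos.ne'
    field_simp
    ring
  rw [ae_iff]
  exact measure_mono_null this (by simp)

/-- For every odd integer `q` and a.e. `ξ ∈ ℝ`,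
`∑_{j≥0} g_r(2^jξ) g_r(2^j(ξ + 2qπ)) = 0`. -/
theorem translation_orthogonality_sum (r : ℕ) (hr : 1 ≤ r) (q : ℤ) (hq : Odd q) :
    ∀ᵐ ξ : ℝ,
      HasSum (fun j : ℕ =>
        waveletProfile r ((2 : ℝ) ^ j * ξ) *
          waveletProfile r ((2 : ℝ) ^ j * (ξ + 2 * (q : ℝ) * π))) 0 := by
  have E : ∀ d : ℝ, ∀ᵐ ξ : ℝ, ∀ j : ℕ, (2 : ℝ) ^ j * (ξ / π + d) ≠ tt r ∧
      (2 : ℝ) ^ j * (ξ / π + d) ≠ 2 ∧ (2 : ℝ) ^ j * (ξ / π + d) ≠ 2 ^ (r + 1) ∧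
      (2 : ℝ) ^ j * (ξ / π + d) ≠ 2 ^ (r + 1) + tt r := by
    intro d
    rw [ae_all_iff]
    intro j
    filter_upwards [ae_ne (tt r) d j, ae_ne 2 d j, ae_ne (2 ^ (r + 1)) d j,
      ae_ne (2 ^ (r + 1) + tt r) d j] with ξ a b c d
    exact ⟨a, b, c, d⟩
  have hpi := Real.pi_pos.ne'
  filter_upwards [E 0, E (2 * q)] with ξ h0 h1
  rcases lt_trichotomy q 0 with hn | hz | hp
  · have := pos_case r hr (-q) hq.neg (by omega) (ξ / π + 2 * q) h1
    convert this using 1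
    funext j
    rw [mul_comm]
    congr 2
    · field_simp
    · push_cast; field_simp; ring
  · subst hz; simp at hq
  · have := pos_case r hr q hq hp (ξ / π + 0) h0
    convert this using 1
    funext j
    congr 2
    · field_simp; ring
    · field_simp; ring
end
end

section
/- Let x, y be real numbers with π < x < y < 2π and x + 2π > 2y. Let K_{x,y} = [x,y] ∪ [2π,2x] ∪ [2y,x+2π] ∪ [y+2π,4π] ∪ [2x+4π,2y+4π]. Then the family {K_{x,y} + 2kπ : k ∈ ℤ} partitions ℝ up to null sets, and the family {2^j K_{x,y} : j ∈ ℤ} partitions (0,∞) up to null sets (so K_{x,y} is an H²-wavelet set). -/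
open MeasureTheory Set Filter Topology
open scoped ENNReal Real

noncomputable section

lemma tr_zero (w v : ℝ) (r : ℤ) (h1 : 2 * π < w) (h2 : w < 4 * π) (h3 : 2 * π ≤ v)
    (h4 : v ≤ 4 * π) (h : v = w + 2 * (r : ℝ) * π) : r = 0 := by
  have hp := Real.pi_pos
  have a : (r : ℝ) < 1 := by
    by_contra hc
    push Not at hc
    nlinarith
  have b : (-1 : ℝ) < r := by
    by_contra hc
    push Not at hc
    nlinarith
  have a' : r < 1 := by exact_mod_cast a
  have b' : -1 < r := by exact_mod_cast b
  omega

lemma dl_zero (x w v : ℝ) (r : ℤ) (hx : 0 < x) (h1 : x < w) (h2 : w < 2 * x) (h3 : x ≤ v)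
    (h4 : v ≤ 2 * x) (h : v = (2 : ℝ) ^ r * w) : r = 0 := by
  have a' : r < 1 := by
    by_contra hc
    push Not at hc
    have := zpow_le_zpow_right₀ (a := (2 : ℝ)) (by norm_num) hc
    rw [zpow_one] at this
    nlinarith
  have b' : -1 < r := by
    by_contra hc
    push Not at hc
    have h' : r ≤ -1 := by omega
    have := zpow_le_zpow_right₀ (a := (2 : ℝ)) (by norm_num) h'
    rw [zpow_neg_one] at this
    nlinarith
  omega

lemma tr_class (x y t w : ℝ) (n k : ℤ)
    (hx : π < x) (hxy : x < y) (hy : y < 2 * π) (h : 2 * y < x + 2 * π)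
    (hw : t = w + 2 * (n : ℝ) * π) (h1 : 2 * π < w) (h2 : w < 4 * π)
    (ht : t ∈ (fun t => t + 2 * (k : ℝ) * π) ''
        (Icc x y ∪ Icc (2 * π) (2 * x) ∪ Icc (2 * y) (x + 2 * π) ∪
         Icc (y + 2 * π) (4 * π) ∪ Icc (2 * x + 4 * π) (2 * y + 4 * π))) :
    (k = n + 1 ∧ x + 2 * π ≤ w ∧ w ≤ y + 2 * π) ∨ (k = n ∧ 2 * π ≤ w ∧ w ≤ 2 * x) ∨
    (k = n ∧ 2 * y ≤ w ∧ w ≤ x + 2 * π) ∨ (k = n ∧ y + 2 * π ≤ w ∧ w ≤ 4 * π) ∨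
    (k = n - 2 ∧ 2 * x ≤ w ∧ w ≤ 2 * y) := by
  have hp := Real.pi_pos
  obtain ⟨u, hu, hut⟩ := ht
  dsimp only at hut
  simp only [mem_union, mem_Icc] at hu
  rcases hu with (((hu | hu) | hu) | hu) | hu
  · have e : u + 2 * π = w + 2 * ((n - k + 1 : ℤ) : ℝ) * π := by push_cast; linarith
    have := tr_zero w (u + 2 * π) _ h1 h2 (by linarith) (by linarith) e
    rw [this] at e; push_cast at e
    exact Or.inl ⟨by omega, by linarith, by linarith⟩
  · have e : u = w + 2 * ((n - k : ℤ) : ℝ) * π := by push_cast; linarith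
    have := tr_zero w u _ h1 h2 (by linarith) (by linarith) e
    rw [this] at e; push_cast at e
    exact Or.inr (Or.inl ⟨by omega, by linarith, by linarith⟩)
  · have e : u = w + 2 * ((n - k : ℤ) : ℝ) * π := by push_cast; linarith
    have := tr_zero w u _ h1 h2 (by linarith) (by linarith) e
    rw [this] at e; push_cast at e
    exact Or.inr (Or.inr (Or.inl ⟨by omega, by linarith, by linarith⟩))
  · have e : u = w + 2 * ((n - k : ℤ) : ℝ) * π := by push_cast; linarith
    have := tr_zero w u _ h1 h2 (by linarith) (by linarith) e
    rw [this] at e; push_cast at e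
    exact Or.inr (Or.inr (Or.inr (Or.inl ⟨by omega, by linarith, by linarith⟩)))
  · have e : u - 4 * π = w + 2 * ((n - k - 2 : ℤ) : ℝ) * π := by push_cast; linarith
    have := tr_zero w (u - 4 * π) _ h1 h2 (by linarith) (by linarith) e
    rw [this] at e; push_cast at e
    exact Or.inr (Or.inr (Or.inr (Or.inr ⟨by omega, by linarith, by linarith⟩)))

lemma dl_step (x t w u : ℝ) (n k a : ℤ) (hx : 0 < x)
    (hw : t = (2 : ℝ) ^ n * w) (h1 : x < w) (h2 : w < 2 * x)
    (hut : (2 : ℝ) ^ k * u = t) (h3 : (2 : ℝ) ^ a * x ≤ u) (h4 : u ≤ (2 : ℝ) ^ a * (2 * x)) :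
    k = n - a ∧ u = (2 : ℝ) ^ a * w := by
  have pk : (0 : ℝ) < 2 ^ k := by positivity
  have pa : (0 : ℝ) < 2 ^ a := by positivity
  have e : u / 2 ^ a = (2 : ℝ) ^ (n - k - a) * w := by
    rw [zpow_sub₀ two_ne_zero, zpow_sub₀ two_ne_zero]
    field_simp
    linarith
  have := dl_zero x w (u / 2 ^ a) _ hx h1 h2 (by rw [le_div_iff₀ pa]; linarith)
    (by rw [div_le_iff₀ pa]; linarith) e
  rw [this, zpow_zero, one_mul, div_eq_iff pa.ne'] at e
  exact ⟨by omega, by linarith⟩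

lemma dl_class (x y t w : ℝ) (n k : ℤ)
    (hx : π < x) (hxy : x < y) (hy : y < 2 * π) (h : 2 * y < x + 2 * π)
    (hw : t = (2 : ℝ) ^ n * w) (h1 : x < w) (h2 : w < 2 * x)
    (ht : t ∈ (fun t => (2 : ℝ) ^ k * t) ''
        (Icc x y ∪ Icc (2 * π) (2 * x) ∪ Icc (2 * y) (x + 2 * π) ∪
         Icc (y + 2 * π) (4 * π) ∪ Icc (2 * x + 4 * π) (2 * y + 4 * π))) :
    (k = n ∧ x ≤ w ∧ w ≤ y) ∨ (k = n ∧ 2 * π ≤ w ∧ w ≤ 2 * x) ∨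
    (k = n - 1 ∧ 2 * y ≤ 2 * w ∧ 2 * w ≤ x + 2 * π) ∨
    (k = n - 1 ∧ y + 2 * π ≤ 2 * w ∧ 2 * w ≤ 4 * π) ∨
    (k = n - 2 ∧ 2 * x + 4 * π ≤ 4 * w ∧ 4 * w ≤ 2 * y + 4 * π) := by
  have hp := Real.pi_pos
  have hx0 : 0 < x := by linarith
  have e0 : (2 : ℝ) ^ (0 : ℤ) = 1 := by norm_num
  have e1 : (2 : ℝ) ^ (1 : ℤ) = 2 := by norm_num
  have e2 : (2 : ℝ) ^ (2 : ℤ) = 4 := by norm_num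
  obtain ⟨u, hu, hut⟩ := ht
  dsimp only at hut
  simp only [mem_union, mem_Icc] at hu
  rcases hu with (((hu | hu) | hu) | hu) | hu
  · obtain ⟨a, b⟩ := dl_step x t w u n k 0 hx0 hw h1 h2 hut
      (by rw [e0]; linarith) (by rw [e0]; linarith)
    rw [e0] at b
    exact Or.inl ⟨by omega, by linarith, by linarith⟩
  · obtain ⟨a, b⟩ := dl_step x t w u n k 0 hx0 hw h1 h2 hut
      (by rw [e0]; linarith) (by rw [e0]; linarith)
    rw [e0] at b
    exact Or.inr (Or.inl ⟨by omega, by linarith, by linarith⟩)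
  · obtain ⟨a, b⟩ := dl_step x t w u n k 1 hx0 hw h1 h2 hut
      (by rw [e1]; linarith) (by rw [e1]; linarith)
    rw [e1] at b
    exact Or.inr (Or.inr (Or.inl ⟨by omega, by linarith, by linarith⟩))
  · obtain ⟨a, b⟩ := dl_step x t w u n k 1 hx0 hw h1 h2 hut
      (by rw [e1]; linarith) (by rw [e1]; linarith)
    rw [e1] at b
    exact Or.inr (Or.inr (Or.inr (Or.inl ⟨by omega, by linarith, by linarith⟩)))
  · obtain ⟨a, b⟩ := dl_step x t w u n k 2 hx0 hw h1 h2 hut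
      (by rw [e2]; linarith) (by rw [e2]; linarith)
    rw [e2] at b
    exact Or.inr (Or.inr (Or.inr (Or.inr ⟨by omega, by linarith, by linarith⟩)))

lemma tr_rep (t : ℝ) : ∃ (n : ℤ) (w : ℝ), t = w + 2 * (n : ℝ) * π ∧ 2 * π ≤ w ∧ w < 4 * π := by
  have hp := Real.pi_pos
  obtain ⟨n, hn, -⟩ := existsUnique_sub_zsmul_mem_Ico (a := 2 * π) (by linarith) t (2 * π)
  simp only [zsmul_eq_mul, mem_Ico] at hn
  exact ⟨n, t - n * (2 * π), by ring, hn.1, by linarith⟩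

lemma dl_rep (x t : ℝ) (hx : 0 < x) (ht : 0 < t) :
    ∃ (n : ℤ) (w : ℝ), t = (2 : ℝ) ^ n * w ∧ x ≤ w ∧ w < 2 * x := by
  obtain ⟨n, hn⟩ := exists_mem_Ico_zpow (div_pos ht hx) (one_lt_two (α := ℝ))
  have pn : (0 : ℝ) < 2 ^ n := by positivity
  rw [mem_Ico, zpow_add_one₀ two_ne_zero, le_div_iff₀ hx, div_lt_iff₀ hx] at hn
  refine ⟨n, t / 2 ^ n, by field_simp, ?_, ?_⟩
  · rw [le_div_iff₀ pn]; linarith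
  · rw [div_lt_iff₀ pn]; linarith

/-- For `π < x < y < 2π` with `x + 2π > 2y`, the five-interval set
`K_{x,y} = [x,y] ∪ [2π,2x] ∪ [2y,x+2π] ∪ [y+2π,4π] ∪ [2x+4π,2y+4π]` is an
`H²`-wavelet set: its `2πℤ`-translates partition `ℝ` and its dyadic dilates
partition `(0,∞)`, up to null sets. -/
theorem five_interval_h2_wavelet_set (x y : ℝ)
    (hx : π < x) (hxy : x < y) (hy : y < 2 * π) (h : 2 * y < x + 2 * π) :
    PartitionUpToNull
      (fun k : ℤ => (fun t => t + 2 * (k : ℝ) * π) ''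
        (Icc x y ∪ Icc (2 * π) (2 * x) ∪ Icc (2 * y) (x + 2 * π) ∪
         Icc (y + 2 * π) (4 * π) ∪ Icc (2 * x + 4 * π) (2 * y + 4 * π)))
      Set.univ ∧
    PartitionUpToNull
      (fun j : ℤ => (fun t => (2 : ℝ) ^ j * t) ''
        (Icc x y ∪ Icc (2 * π) (2 * x) ∪ Icc (2 * y) (x + 2 * π) ∪
         Icc (y + 2 * π) (4 * π) ∪ Icc (2 * x + 4 * π) (2 * y + 4 * π)))
      (Ioi 0) := by
  have hp := Real.pi_pos
  have hx0 : 0 < x := by linarith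
  refine ⟨⟨?_, ?_⟩, ⟨?_, ?_⟩⟩
  · intro i j hij
    have hc : (⋃ n : ℤ, (fun w => w + 2 * (n : ℝ) * π) ''
        ({2 * π, 2 * x, 2 * y, x + 2 * π, y + 2 * π} : Set ℝ)).Countable :=
      countable_iUnion fun n => (Set.Countable.image (Set.toFinite _).countable _)
    refine measure_mono_null ?_ (hc.measure_zero volume)
    rintro t ⟨hi, hj⟩
    obtain ⟨n, w, hw, h1, h2⟩ := tr_rep t
    refine mem_iUnion.2 ⟨n, w, ?_, hw.symm⟩
    simp only [mem_insert_iff, mem_singleton_iff]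
    rcases h1.eq_or_lt with h1 | h1
    · exact Or.inl h1.symm
    by_contra hne
    simp only [not_or] at hne
    obtain ⟨n1, n2, n3, n4, n5⟩ := hne
    rcases tr_class x y t w n i hx hxy hy h hw h1 h2 hi with a | a | a | a | a <;>
    rcases tr_class x y t w n j hx hxy hy h hw h1 h2 hj with b | b | b | b | b <;>
    obtain ⟨a1, a2, a3⟩ := a <;> obtain ⟨b1, b2, b3⟩ := b <;>
    first
    | exact hij (by omega)
    | linarith
    | exact n2 (by linarith)
    | exact n3 (by linarith)
    | exact n4 (by linarith)
    | exact n5 (by linarith)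
  · convert measure_empty (μ := (volume : Measure ℝ))
    rw [← Set.bot_eq_empty, symmDiff_eq_bot]
    refine eq_univ_of_forall fun t => ?_
    obtain ⟨n, w, hw, h1, h2⟩ := tr_rep t
    simp only [mem_iUnion, mem_image, mem_union, mem_Icc]
    rcases le_total w (2 * x) with c1 | c1
    · exact ⟨n, w, by grind, hw.symm⟩
    rcases le_total w (2 * y) with c2 | c2
    · exact ⟨n - 2, w + 4 * π, Or.inr ⟨by linarith, by linarith⟩, by push_cast; linarith⟩
    rcases le_total w (x + 2 * π) with c3 | c3
    · exact ⟨n, w, by grind, hw.symm⟩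
    rcases le_total w (y + 2 * π) with c4 | c4
    · exact ⟨n + 1, w - 2 * π, Or.inl (Or.inl (Or.inl (Or.inl ⟨by linarith, by linarith⟩))),
        by push_cast; linarith⟩
    · exact ⟨n, w, by grind, hw.symm⟩
  · intro i j hij
    have hc : (⋃ n : ℤ, (fun w => (2 : ℝ) ^ n * w) ''
        ({x, y, x / 2 + π, y / 2 + π, 2 * π} : Set ℝ)).Countable :=
      countable_iUnion fun n => (Set.Countable.image (Set.toFinite _).countable _)
    refine measure_mono_null ?_ (hc.measure_zero volume)
    rintro t ⟨hi, hj⟩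
    have ht : 0 < t := by
      obtain ⟨u, hu, rfl⟩ := hi
      have : 0 < u := by
        simp only [mem_union, mem_Icc] at hu
        rcases hu with (((hu | hu) | hu) | hu) | hu <;> linarith
      positivity
    obtain ⟨n, w, hw, h1, h2⟩ := dl_rep x t hx0 ht
    refine mem_iUnion.2 ⟨n, w, ?_, hw.symm⟩
    simp only [mem_insert_iff, mem_singleton_iff]
    rcases h1.eq_or_lt with h1 | h1
    · exact Or.inl h1.symm
    by_contra hne
    simp only [not_or] at hne
    obtain ⟨n1, n2, n3, n4, n5⟩ := hne
    rcases dl_class x y t w n i hx hxy hy h hw h1 h2 hi with a | a | a | a | a <;>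
    rcases dl_class x y t w n j hx hxy hy h hw h1 h2 hj with b | b | b | b | b <;>
    obtain ⟨a1, a2, a3⟩ := a <;> obtain ⟨b1, b2, b3⟩ := b <;>
    first
    | exact hij (by omega)
    | linarith
    | exact n2 (by linarith)
    | exact n3 (by linarith)
    | exact n4 (by linarith)
    | exact n5 (by linarith)
  · convert measure_empty (μ := (volume : Measure ℝ))
    rw [← Set.bot_eq_empty, symmDiff_eq_bot]
    ext t
    constructor
    · intro hi
      obtain ⟨k, u, hu, rfl⟩ := mem_iUnion.1 hi
      have : 0 < u := by
        simp only [mem_union, mem_Icc] at hu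
        rcases hu with (((hu | hu) | hu) | hu) | hu <;> linarith
      have : 0 < (2 : ℝ) ^ k * u := by positivity
      exact this
    intro ht
    obtain ⟨n, w, hw, h1, h2⟩ := dl_rep x t hx0 ht
    have s1 : (2 : ℝ) ^ (n - 1) * (2 * w) = t := by
      rw [hw, zpow_sub₀ two_ne_zero, zpow_one]; ring
    have s2 : (2 : ℝ) ^ (n - 2) * (4 * w) = t := by
      rw [hw, zpow_sub₀ two_ne_zero, show (2 : ℝ) ^ (2 : ℤ) = 4 by norm_num]; ring
    simp only [mem_iUnion, mem_image, mem_union, mem_Icc]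
    rcases le_total w y with c1 | c1
    · exact ⟨n, w, by grind, hw.symm⟩
    rcases le_total w (x / 2 + π) with c2 | c2
    · exact ⟨n - 1, 2 * w, Or.inl (Or.inl (Or.inr ⟨by linarith, by linarith⟩)), s1⟩
    rcases le_total w (y / 2 + π) with c3 | c3
    · exact ⟨n - 2, 4 * w, Or.inr ⟨by linarith, by linarith⟩, s2⟩
    rcases le_total w (2 * π) with c4 | c4
    · exact ⟨n - 1, 2 * w, Or.inl (Or.inr ⟨by linarith, by linarith⟩), s1⟩
    · exact ⟨n, w, by grind, hw.symm⟩
end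
end

section
/- Let K₁, K₂ ⊆ (0,∞) be measurable sets such that K₁ is both translation equivalent and dilation equivalent to K₂. Then K₁ satisfies the two H²-wavelet-set partition conditions (translates {K₁ + 2kπ : k ∈ ℤ} partition ℝ up to null sets and dilates {2^j K₁ : j ∈ ℤ} partition (0,∞) up to null sets) if and only if K₂ satisfies them. -/
open MeasureTheory Set Filter Topology
open scoped ENNReal Real

noncomputable section

/-- A countable exact partition of a set. -/
def ExactPartition (A : ℕ → Set ℝ) (S : Set ℝ) : Prop :=
  (∀ m n : ℕ, m ≠ n → A m ∩ A n = ∅) ∧ (⋃ n, A n) = S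

/-- `A` is translation equivalent to `B`: there is a countable measurable partition
`{Aₙ}` of `A` and integers `kₙ` such that `{Aₙ + 2kₙπ}` is a partition of `B`
up to null sets. -/
def TranslationEquiv (A B : Set ℝ) : Prop :=
  ∃ (P : ℕ → Set ℝ) (k : ℕ → ℤ),
    (∀ n, MeasurableSet (P n)) ∧ ExactPartition P A ∧
    PartitionUpToNull (fun n => (fun x => x + 2 * (k n : ℝ) * π) '' P n) B

/-- `A` is dilation equivalent to `B`: there is a countable measurable partition
`{Aₙ'}` of `A` and integers `jₙ` such that `{2^{jₙ} Aₙ'}` is a partition of `B`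
up to null sets. -/
def DyadicDilationEquiv (A B : Set ℝ) : Prop :=
  ∃ (P : ℕ → Set ℝ) (j : ℕ → ℤ),
    (∀ n, MeasurableSet (P n)) ∧ ExactPartition P A ∧
    PartitionUpToNull (fun n => (fun x => (2 : ℝ) ^ (j n) * x) '' P n) B

theorem partition_ae {ι : Type*} [Countable ι] (A : ι → Set ℝ) (S : Set ℝ) :
    PartitionUpToNull A S ↔ ∀ᵐ x : ℝ, (∀ i j, x ∈ A i → x ∈ A j → i = j) ∧
      ((∃ i, x ∈ A i) ↔ x ∈ S) := by
  unfold PartitionUpToNull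
  rw [eventually_and]
  refine and_congr ?_ ?_
  · rw [ae_all_iff]
    refine forall_congr' fun i => ?_
    rw [ae_all_iff]
    refine forall_congr' fun j => ?_
    by_cases hij : i = j
    · simp [hij]
    · simp only [hij, ne_eq, not_false_eq_true, forall_const, imp_false, ← not_and]
      rw [measure_eq_zero_iff_ae_notMem]
      rfl
  · rw [measure_eq_zero_iff_ae_notMem]
    refine eventually_congr (Eventually.of_forall fun x => ?_)
    rw [mem_symmDiff, mem_iUnion]
    tauto

theorem equiv_core (e : ℤ → ℝ → ℝ) (h0 : ∀ x, e 0 x = x)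
    (hadd : ∀ a b x, e (a + b) x = e a (e b x))
    (hnull : ∀ k, Measure.QuasiMeasurePreserving (e k) volume volume)
    (A B S : Set ℝ) (P : ℕ → Set ℝ) (k : ℕ → ℤ) (hP : ExactPartition P A)
    (hB : PartitionUpToNull (fun n => e (k n) '' P n) B) :
    PartitionUpToNull (fun i : ℤ => e i '' A) S ↔
      PartitionUpToNull (fun i : ℤ => e i '' B) S := by
  have him : ∀ (a : ℤ) (s : Set ℝ) (x : ℝ), x ∈ e a '' s ↔ e (-a) x ∈ s := by
    intro a s x
    constructor
    · rintro ⟨y, hy, rfl⟩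
      rw [← hadd]; simpa [h0] using hy
    · intro h
      exact ⟨_, h, by rw [← hadd]; simp [h0]⟩
  obtain ⟨hd, hU⟩ := hP
  have hd' : ∀ m n x, x ∈ P m → x ∈ P n → m = n := by
    intro m n x hm hn
    by_contra hne
    have : x ∈ P m ∩ P n := ⟨hm, hn⟩
    rw [hd m n hne] at this
    exact this
  have hA : ∀ x, x ∈ A ↔ ∃ n, x ∈ P n := by intro x; rw [← hU, mem_iUnion]
  rw [partition_ae] at hB
  have hall := ae_all_iff.2 fun c : ℤ => (hnull c).ae hB
  rw [partition_ae, partition_ae]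
  refine eventually_congr ?_
  filter_upwards [hall] with x hx
  simp only [him, ← hadd] at hx ⊢
  refine and_congr ⟨fun H i j hi hj => ?_, fun H i j hi hj => ?_⟩ (iff_congr ?_ Iff.rfl)
  · obtain ⟨n, hn⟩ := (hx (-i)).2.2 hi
    obtain ⟨m, hm⟩ := (hx (-j)).2.2 hj
    have h1 := H (k n + i) (k m + j) ((hA _).2 ⟨n, by convert hn using 2; ring⟩)
      ((hA _).2 ⟨m, by convert hm using 2; ring⟩)
    have h2 : n = m := by
      refine hd' _ _ _ hn ?_
      convert hm using 2
      lia
    subst h2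
    lia
  · obtain ⟨n, hn⟩ := (hA _).1 hi
    obtain ⟨m, hm⟩ := (hA _).1 hj
    have hn' : e (-k n + (k n - i)) x ∈ P n := by convert hn using 2; ring
    have hm' : e (-k m + (k m - j)) x ∈ P m := by convert hm using 2; ring
    have h1 := H (i - k n) (j - k m)
      (by rw [neg_sub]; exact (hx (k n - i)).2.1 ⟨n, hn'⟩)
      (by rw [neg_sub]; exact (hx (k m - j)).2.1 ⟨m, hm'⟩)
    have h2 : n = m := by
      refine (hx (k n - i)).1 n m hn' ?_
      convert hm' using 3
      lia
    subst h2
    lia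
  · constructor
    · rintro ⟨i, hi⟩
      obtain ⟨n, hn⟩ := (hA _).1 hi
      refine ⟨i - k n, ?_⟩
      rw [neg_sub]
      exact (hx (k n - i)).2.1 ⟨n, by convert hn using 2; ring⟩
    · rintro ⟨i, hi⟩
      obtain ⟨n, hn⟩ := (hx (-i)).2.2 hi
      exact ⟨k n + i, (hA _).2 ⟨n, by convert hn using 2; ring⟩⟩

/-- If `K₁, K₂ ⊆ (0,∞)` are measurable and `K₁` is both translation and
dilation equivalent to `K₂`, then `K₁` is an `H²`-wavelet set iff `K₂` is. -/
theorem wavelet_set_of_translation_dilation_equiv (K₁ K₂ : Set ℝ)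
    (h₁ : MeasurableSet K₁) (h₂ : MeasurableSet K₂)
    (h₁pos : K₁ ⊆ Ioi (0 : ℝ)) (h₂pos : K₂ ⊆ Ioi (0 : ℝ))
    (hT : TranslationEquiv K₁ K₂) (hD : DyadicDilationEquiv K₁ K₂) :
    (PartitionUpToNull (fun k : ℤ => (fun x => x + 2 * (k : ℝ) * π) '' K₁) Set.univ ∧
     PartitionUpToNull (fun j : ℤ => (fun x => (2 : ℝ) ^ j * x) '' K₁) (Ioi 0)) ↔
    (PartitionUpToNull (fun k : ℤ => (fun x => x + 2 * (k : ℝ) * π) '' K₂) Set.univ ∧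
     PartitionUpToNull (fun j : ℤ => (fun x => (2 : ℝ) ^ j * x) '' K₂) (Ioi 0)) := by
  obtain ⟨P, k, -, hP, hPB⟩ := hT
  obtain ⟨Q, j, -, hQ, hQB⟩ := hD
  refine and_congr ?_ ?_
  · refine equiv_core (fun (k : ℤ) x => x + 2 * (k : ℝ) * π) (by simp)
      (fun a b x => by push_cast; ring) (fun k => ?_) K₁ K₂ _ P k hP hPB
    exact (measurePreserving_add_right volume _).quasiMeasurePreserving
  · refine equiv_core (fun (k : ℤ) x => (2 : ℝ) ^ k * x) (by simp)
      (fun a b x => by simp only [zpow_add₀ (two_ne_zero' ℝ)]; ring) (fun k => ?_) K₁ K₂ _ Q j hQ hQB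
    refine ⟨by fun_prop, ?_⟩
    refine Measure.AbsolutelyContinuous.mk fun s hs h => ?_
    rw [Measure.map_apply (by fun_prop) hs,
      Real.volume_preimage_mul_left (zpow_ne_zero _ two_ne_zero), h, mul_zero]
end
end

section
/- Fix an integer r ≥ 1 and a real ε with 0 < ε < (2^r − 1)π/(2^{r+1} − 1). Then the set K_{r,ε} = (J_r \ ⋃_{n≥0} E_n) ∪ (⋃_{n≥0} F_n) ∪ S₁ ∪ S₂ ∪ S₃ satisfies: the family {K_{r,ε} + 2kπ : k ∈ ℤ} partitions ℝ up to null sets, and the family {2^j K_{r,ε} : j ∈ ℤ} partitions (0,∞) up to null sets (so K_{r,ε} is an H²-wavelet set). -/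
open MeasureTheory Set Filter Topology
open scoped ENNReal Real

noncomputable section

/-- `S₁ = [t_r/2 + ε/2^{r+1}, t_r/2 + ε]`. -/
def setS1 (r : ℕ) (ε : ℝ) : Set ℝ := Icc (tPt r / 2 + ε / 2 ^ (r + 1)) (tPt r / 2 + ε)

/-- `S₂ = [t_r + 2ε, 2π]`. -/
def setS2 (r : ℕ) (ε : ℝ) : Set ℝ := Icc (tPt r + 2 * ε) (2 * π)

/-- `S₃ = [2^{r+1}t_r, 2^{r+1}t_r + 2ε]`. -/
def setS3 (r : ℕ) (ε : ℝ) : Set ℝ :=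
  Icc (2 ^ (r + 1) * tPt r) (2 ^ (r + 1) * tPt r + 2 * ε)

/-- `E₀ = S₁ + 2^{r+1}π` and `Eₙ₊₁ = Fₙ + 2^{r+1}π = 2^{-(n+r+2)}Eₙ + 2^{r+1}π`. -/
def setE (r : ℕ) (ε : ℝ) : ℕ → Set ℝ
  | 0 => shift (setS1 r ε) (2 ^ (r + 1) * π)
  | n + 1 => shift (scale ((2 : ℝ) ^ (n + r + 2))⁻¹ (setE r ε n)) (2 ^ (r + 1) * π)

/-- `Fₙ = 2^{-(n+r+2)}Eₙ`. -/
def setF (r : ℕ) (ε : ℝ) (n : ℕ) : Set ℝ := scale ((2 : ℝ) ^ (n + r + 2))⁻¹ (setE r ε n)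

/-- `K_{r,ε} = (J_r \ ⋃ₙ Eₙ) ∪ (⋃ₙ Fₙ) ∪ S₁ ∪ S₂ ∪ S₃`. -/
def Kre (r : ℕ) (ε : ℝ) : Set ℝ :=
  (Jr r \ ⋃ n, setE r ε n) ∪ (⋃ n, setF r ε n) ∪ setS1 r ε ∪ setS2 r ε ∪ setS3 r ε

theorem partition_aux (T : ℤ → ℝ → ℝ) (hT0 : ∀ x, T 0 x = x)
    (hTa : ∀ a b x, T a (T b x) = T (a + b) x) (S K D B : Set ℝ) (R : ℤ → ℝ → Prop)
    (hB : B.Countable) (hS : ∀ a x, x ∈ S → T a x ∈ S) (hKS : K ⊆ S)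
    (hD : ∀ x ∈ S, ∃ a, T a x ∈ D)
    (hDB : ∀ z w m, z ∈ D → w ∈ D → z ∉ B → w ∉ B → T m z = w → m = 0)
    (hRD : ∀ a z, R a z → z ∈ D) (hDR : ∀ z ∈ D, ∃ a, R a z)
    (hRR : ∀ a b z, R a z → R b z → z ∉ B → a = b)
    (hKR : ∀ x ∈ K, ∃ a, R a (T a x)) (hRK : ∀ a z, R a z → T (-a) z ∈ K) :
    PartitionUpToNull (fun k : ℤ => (T k) '' K) S := by
  constructor
  · intro i j hij
    have hc : (⋃ k : ℤ, (T k) '' B).Countable := countable_iUnion fun k => hB.image _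
    refine measure_mono_null ?_ (hc.measure_zero volume)
    rintro u ⟨⟨x, hx, rfl⟩, ⟨y, hy, hxy⟩⟩
    obtain ⟨a, ha⟩ := hKR x hx
    obtain ⟨b, hb⟩ := hKR y hy
    by_cases hz : T a x ∈ B
    · refine mem_iUnion.2 ⟨i - a, T a x, hz, ?_⟩
      rw [hTa]; congr 1; ring
    by_cases hw : T b y ∈ B
    · refine mem_iUnion.2 ⟨j - b, T b y, hw, ?_⟩
      rw [hTa, ← hxy]; congr 1; ring
    exfalso
    have h1 : T (b + i - j - a) (T a x) = T b y := by
      have h2 : T (b - j) (T j y) = T (b - j) (T i x) := by rw [hxy]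
      rw [hTa, hTa] at h2
      rw [hTa]
      have e1 : b - j + j = b := by ring
      have e2 : b + i - j - a + a = b - j + i := by ring
      rw [e2, ← h2, e1]
    have h3 := hDB _ _ _ (hRD _ _ ha) (hRD _ _ hb) hz hw h1
    rw [h3, hT0] at h1
    rw [← h1] at hb
    have := hRR _ _ _ ha hb hz
    omega
  · have : (⋃ k : ℤ, (T k) '' K) = S := by
      ext x
      constructor
      · intro h
        obtain ⟨k, y, hy, rfl⟩ := mem_iUnion.1 h
        exact hS _ _ (hKS hy)
      · intro h
        obtain ⟨a, ha⟩ := hD x h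
        obtain ⟨b, hb⟩ := hDR _ ha
        refine mem_iUnion.2 ⟨b - a, _, hRK _ _ hb, ?_⟩
        rw [hTa, hTa]
        have : b - a + (-b + a) = 0 := by ring
        rw [← add_assoc] at this
        rw [show b - a + -b + a = 0 by ring, hT0]
    rw [this]; simp

theorem mem_setF_iff (r : ℕ) (ε : ℝ) (n : ℕ) (x : ℝ) :
    x ∈ setF r ε n ↔ (2 : ℝ) ^ (n + r + 2) * x ∈ setE r ε n := by
  have h : (2 : ℝ) ^ (n + r + 2) ≠ 0 := by positivity
  simp only [setF, scale, mem_image]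
  constructor
  · rintro ⟨y, hy, rfl⟩
    rwa [mul_inv_cancel_left₀ h]
  · intro hx
    exact ⟨_, hx, inv_mul_cancel_left₀ h _⟩

theorem mem_setE_zero (r : ℕ) (ε : ℝ) (x : ℝ) :
    x + 2 ^ (r + 1) * π ∈ setE r ε 0 ↔ x ∈ setS1 r ε := by
  simp [setE, shift]

theorem mem_setE_succ (r : ℕ) (ε : ℝ) (n : ℕ) (x : ℝ) :
    x + 2 ^ (r + 1) * π ∈ setE r ε (n + 1) ↔ x ∈ setF r ε n := by
  simp [setE, shift, setF]

theorem mem_Kre_iff (r : ℕ) (ε : ℝ) (x : ℝ) :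
    x ∈ Kre r ε ↔ (x ∈ Jr r ∧ ∀ n, x ∉ setE r ε n) ∨
      (∃ n, x + 2 ^ (r + 1) * π ∈ setE r ε n) ∨ x ∈ setS2 r ε ∨ x ∈ setS3 r ε := by
  have : (∃ n, x + 2 ^ (r + 1) * π ∈ setE r ε n) ↔ (∃ n, x ∈ setF r ε n) ∨ x ∈ setS1 r ε := by
    constructor
    · rintro ⟨n, hn⟩
      cases n with
      | zero => exact Or.inr ((mem_setE_zero _ _ _).1 hn)
      | succ n => exact Or.inl ⟨n, (mem_setE_succ _ _ _ _).1 hn⟩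
    · rintro (⟨n, hn⟩ | h)
      · exact ⟨n + 1, (mem_setE_succ _ _ _ _).2 hn⟩
      · exact ⟨0, (mem_setE_zero _ _ _).2 h⟩
  rw [this]
  simp only [Kre, mem_union, Set.mem_sdiff, mem_iUnion, not_exists]
  tauto

structure Good (r : ℕ) (ε : ℝ) : Prop where
  t1 : π < tPt r
  t2 : tPt r + 2 * ε < 2 * π
  Nt : 2 ^ (r + 1) * tPt r = 2 ^ (r + 1) * π + tPt r
  N : (4 : ℝ) ≤ 2 ^ (r + 1)
  e0 : 0 < ε

theorem good_of (r : ℕ) (hr : 1 ≤ r) (ε : ℝ)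
    (hε0 : 0 < ε) (hε1 : ε < (2 ^ r - 1) * π / (2 ^ (r + 1) - 1)) : Good r ε := by
  have hN : (4 : ℝ) ≤ 2 ^ (r + 1) := by
    calc (4 : ℝ) = 2 ^ 2 := by norm_num
      _ ≤ 2 ^ (r + 1) := pow_le_pow_right₀ (by norm_num) (by omega)
  have hN1 : (0 : ℝ) < 2 ^ (r + 1) - 1 := by linarith
  have ht : tPt r * (2 ^ (r + 1) - 1) = 2 ^ (r + 1) * π := by
    unfold tPt; field_simp
  have hpi := Real.pi_pos
  rw [lt_div_iff₀ hN1] at hε1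
  have h2 : (2 : ℝ) ^ (r + 1) = 2 * 2 ^ r := by ring
  refine ⟨?_, ?_, by linarith, hN, hε0⟩
  · nlinarith
  · by_contra hcon
    push Not at hcon
    have := mul_le_mul_of_nonneg_right hcon hN1.le
    rw [h2] at this hε1 ht
    nlinarith

theorem setE_bd {r : ℕ} {ε : ℝ} (g : Good r ε) (n : ℕ) (x : ℝ)
    (hx : x + 2 ^ (r + 1) * π ∈ setE r ε n) :
    tPt r / 2 < 2 ^ n * x ∧ 2 ^ n * x ≤ tPt r := by
  obtain ⟨t1, t2, Nt, N, e0⟩ := g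
  have hpi := Real.pi_pos
  induction n generalizing x with
  | zero =>
    rw [mem_setE_zero] at hx
    have : 0 < ε / 2 ^ (r + 1) := by positivity
    simp only [setS1, mem_Icc] at hx
    constructor <;> linarith [hx.1, hx.2]
  | succ n ih =>
    rw [mem_setE_succ, mem_setF_iff] at hx
    obtain ⟨h1, h2⟩ := ih (2 ^ (n + r + 2) * x - 2 ^ (r + 1) * π) (by simpa using hx)
    set y := (2 : ℝ) ^ (n + r + 2) * x - 2 ^ (r + 1) * π with hy
    have hn : (1 : ℝ) ≤ 2 ^ n := one_le_pow₀ (by norm_num)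
    have hy0 : 0 < y := by
      by_contra h
      push Not at h
      nlinarith
    have hyt : y ≤ tPt r := by nlinarith
    have e : (2 : ℝ) ^ (n + r + 2) * x = 2 ^ (r + 1) * (2 ^ (n + 1) * x) := by ring
    have hN0 : (0 : ℝ) < 2 ^ (r + 1) := by positivity
    rw [e] at hy
    constructor
    · have : π < 2 ^ (n + 1) * x := by
        refine lt_of_mul_lt_mul_left ?_ hN0.le
        linarith
      linarith
    · refine le_of_mul_le_mul_left ?_ hN0
      linarith

theorem setE_J {r : ℕ} {ε : ℝ} (g : Good r ε) (n : ℕ) (x : ℝ)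
    (hx : x + 2 ^ (r + 1) * π ∈ setE r ε n) : 0 < x ∧ x ≤ tPt r := by
  obtain ⟨h1, h2⟩ := setE_bd g n x hx
  obtain ⟨t1, t2, Nt, N, e0⟩ := g
  have hpi := Real.pi_pos
  have hn : (1 : ℝ) ≤ 2 ^ n := one_le_pow₀ (by norm_num)
  have hy0 : 0 < x := by
    by_contra h
    push Not at h
    nlinarith
  exact ⟨hy0, by nlinarith⟩

theorem setE_lt {r : ℕ} {ε : ℝ} (g : Good r ε) (n m : ℕ) (x : ℝ)
    (hx : x + 2 ^ (r + 1) * π ∈ setE r ε n) (hy : x + 2 ^ (r + 1) * π ∈ setE r ε m) :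
    ¬ n < m := by
  intro hnm
  obtain ⟨h1, h2⟩ := setE_bd g n x hx
  obtain ⟨h3, h4⟩ := setE_bd g m x hy
  obtain ⟨h5, h6⟩ := setE_J g n x hx
  have : (2 : ℝ) ^ (n + 1) ≤ 2 ^ m := pow_le_pow_right₀ (by norm_num) hnm
  rw [pow_succ] at this
  nlinarith

theorem setE_disj {r : ℕ} {ε : ℝ} (g : Good r ε) (n m : ℕ) (x : ℝ)
    (hx : x ∈ setE r ε n) (hy : x ∈ setE r ε m) : n = m := by
  have e : x = (x - 2 ^ (r + 1) * π) + 2 ^ (r + 1) * π := by ring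
  rw [e] at hx hy
  have := setE_lt g _ _ _ hx hy
  have := setE_lt g _ _ _ hy hx
  omega

theorem trans_part {r : ℕ} {ε : ℝ} (g : Good r ε) :
    PartitionUpToNull
      (fun k : ℤ => (fun x => x + 2 * (k : ℝ) * π) '' Kre r ε) Set.univ := by
  have hpi := Real.pi_pos
  have hJ := setE_J g
  obtain ⟨t1, t2, Nt, N, e0⟩ := g
  refine partition_aux (fun k x => x + 2 * (k : ℝ) * π) (by simp)
    (by intros; push_cast; ring) univ _ (Icc 0 (2 * π))
    {0, tPt r, tPt r + 2 * ε, 2 * π}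
    (fun a z => (a = 0 ∧ ((∃ n, z + 2 ^ (r + 1) * π ∈ setE r ε n) ∨ z ∈ setS2 r ε)) ∨
      (a = - 2 ^ r ∧ ((0 ≤ z ∧ z ≤ tPt r ∧ ∀ n, z + 2 ^ (r + 1) * π ∉ setE r ε n) ∨
        (tPt r ≤ z ∧ z ≤ tPt r + 2 * ε))))
    (Set.Finite.countable (by simp)) (by simp) (by simp) ?_ ?_ ?_ ?_ ?_ ?_ ?_
  · intro x _
    refine ⟨- ⌊x / (2 * π)⌋, ?_⟩
    have h1 := Int.floor_le (x / (2 * π))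
    have h2 := Int.lt_floor_add_one (x / (2 * π))
    rw [le_div_iff₀ (by positivity)] at h1
    rw [div_lt_iff₀ (by positivity)] at h2
    push_cast
    constructor <;> linarith
  · intro z w m hz hw hzB hwB h
    simp only [mem_insert_iff, mem_singleton_iff, not_or] at hzB hwB
    have z0 := lt_of_le_of_ne hz.1 (Ne.symm hzB.1)
    have z1 := lt_of_le_of_ne hz.2 hzB.2.2.2
    have w0 := lt_of_le_of_ne hw.1 (Ne.symm hwB.1)
    have w1 := lt_of_le_of_ne hw.2 hwB.2.2.2
    have h' : z + 2 * (m : ℝ) * π = w := h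
    have m1 : (m : ℝ) < 1 := by by_contra hc; push Not at hc; nlinarith
    have m2 : (-1 : ℝ) < m := by by_contra hc; push Not at hc; nlinarith
    have m1' : m < 1 := by exact_mod_cast m1
    have m2' : -1 < m := by exact_mod_cast m2
    omega
  · rintro a z (⟨-, ⟨n, hn⟩ | h⟩ | ⟨-, ⟨h1, h2, -⟩ | ⟨h1, h2⟩⟩)
    · obtain ⟨h1, h2⟩ := hJ _ _ hn
      constructor <;> linarith
    · obtain ⟨h1, h2⟩ := h
      constructor <;> linarith
    · constructor <;> linarith
    · constructor <;> linarith
  · intro z hz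
    by_cases hU : ∃ n, z + 2 ^ (r + 1) * π ∈ setE r ε n
    · exact ⟨0, Or.inl ⟨rfl, Or.inl hU⟩⟩
    by_cases hz1 : z ≤ tPt r
    · exact ⟨_, Or.inr ⟨rfl, Or.inl ⟨hz.1, hz1, not_exists.1 hU⟩⟩⟩
    push Not at hz1
    by_cases hz2 : z ≤ tPt r + 2 * ε
    · exact ⟨_, Or.inr ⟨rfl, Or.inr ⟨hz1.le, hz2⟩⟩⟩
    push Not at hz2
    exact ⟨0, Or.inl ⟨rfl, Or.inr ⟨hz2.le, hz.2⟩⟩⟩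
  · have key : ∀ z, z ∉ ({0, tPt r, tPt r + 2 * ε, 2 * π} : Set ℝ) →
        ((∃ n, z + 2 ^ (r + 1) * π ∈ setE r ε n) ∨ z ∈ setS2 r ε) →
        ((0 ≤ z ∧ z ≤ tPt r ∧ ∀ n, z + 2 ^ (r + 1) * π ∉ setE r ε n) ∨
        (tPt r ≤ z ∧ z ≤ tPt r + 2 * ε)) → False := by
      intro z hzB h1 h2
      simp only [mem_insert_iff, mem_singleton_iff, not_or] at hzB
      obtain ⟨b1, b2, b3, b4⟩ := hzB
      rcases h1 with ⟨n, hn⟩ | ⟨h, h'⟩ <;> rcases h2 with ⟨h3, h4, h5⟩ | ⟨h3, h4⟩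
      · exact h5 n hn
      · exact b2 (le_antisymm (hJ _ _ hn).2 h3)
      · linarith
      · exact b3 (le_antisymm h4 h)
    rintro a b z (⟨rfl, h1⟩ | ⟨rfl, h1⟩) (⟨rfl, h2⟩ | ⟨rfl, h2⟩) hzB
    · rfl
    · exact (key z hzB h1 h2).elim
    · exact (key z hzB h2 h1).elim
    · rfl
  · intro x hx
    have e : x + 2 * ((- 2 ^ r : ℤ) : ℝ) * π = x - 2 ^ (r + 1) * π := by push_cast; ring
    rw [mem_Kre_iff] at hx
    rcases hx with ⟨h1, h2⟩ | h | h | h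
    · refine ⟨- 2 ^ r, Or.inr ⟨rfl, Or.inl ?_⟩⟩
      simp only [e, sub_add_cancel]
      exact ⟨by linarith [h1.1], by linarith [h1.2], h2⟩
    · exact ⟨0, Or.inl ⟨rfl, Or.inl (by simpa using h)⟩⟩
    · exact ⟨0, Or.inl ⟨rfl, Or.inr (by simpa using h)⟩⟩
    · refine ⟨- 2 ^ r, Or.inr ⟨rfl, Or.inr ?_⟩⟩
      simp only [e]
      exact ⟨by linarith [h.1], by linarith [h.2]⟩
  · intro a z h
    rw [mem_Kre_iff]
    rcases h with ⟨rfl, h⟩ | ⟨rfl, h⟩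
    · have e : z + 2 * ((-0 : ℤ) : ℝ) * π = z := by simp
      simp only [e]
      tauto
    · have e : z + 2 * ((- - 2 ^ r : ℤ) : ℝ) * π = z + 2 ^ (r + 1) * π := by push_cast; ring
      simp only [e]
      rcases h with ⟨h1, h2, h3⟩ | ⟨h1, h2⟩
      · exact Or.inl ⟨⟨by linarith, by linarith⟩, h3⟩
      · exact Or.inr (Or.inr (Or.inr ⟨by linarith, by linarith⟩))

theorem dil_part {r : ℕ} {ε : ℝ} (g : Good r ε) :
    PartitionUpToNull
      (fun j : ℤ => (fun x => (2 : ℝ) ^ j * x) '' Kre r ε) (Ioi 0) := by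
  have hpi := Real.pi_pos
  have hJ := setE_J g
  have hdisj := setE_disj g
  obtain ⟨t1, t2, Nt, N, e0⟩ := g
  have hN0 : (0 : ℝ) < 2 ^ (r + 1) := by positivity
  have hd0 : 0 < ε / 2 ^ (r + 1) := by positivity
  have hNd : 2 ^ (r + 1) * (ε / 2 ^ (r + 1)) = ε := by field_simp
  set N' : ℝ := 2 ^ (r + 1) with hN'
  set d : ℝ := ε / N' with hd
  have hdε : d < ε := by nlinarith
  have hzN : (2 : ℝ) ^ ((r : ℤ) + 1) = N' := by
    rw [hN']; exact_mod_cast zpow_natCast (2 : ℝ) (r + 1)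
  have hzN' : ∀ z : ℝ, (2 : ℝ) ^ (-((r : ℤ) + 1)) * z = N'⁻¹ * z := by
    intro z; rw [zpow_neg, hzN]
  have hzn : ∀ n : ℕ, (2 : ℝ) ^ ((n : ℤ) + 1) = 2 ^ (n + 1) := by
    intro n; exact_mod_cast zpow_natCast (2 : ℝ) (n + 1)
  have hJ' : ∀ n z, N' * z ∈ setE r ε n → π ≤ z ∧ z ≤ tPt r := by
    intro n z h
    obtain ⟨h1, h2⟩ := hJ n (N' * z - N' * π) (by simpa using h)
    exact ⟨by nlinarith, le_of_mul_le_mul_left (by linarith) hN0⟩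
  refine partition_aux (fun k x => (2 : ℝ) ^ k * x) (by simp)
    (by intro a b x; rw [zpow_add₀ (by norm_num)]; ring) (Ioi 0) _ (Icc π (2 * π))
    {π, tPt r, tPt r + 2 * d, tPt r + 2 * ε, 2 * π}
    (fun a z => (a = 0 ∧ z ∈ setS2 r ε) ∨
      (a = 1 ∧ tPt r + 2 * d ≤ z ∧ z ≤ tPt r + 2 * ε) ∨
      (a = - ((r : ℤ) + 1) ∧ ((tPt r ≤ z ∧ z ≤ tPt r + 2 * d) ∨
        (π ≤ z ∧ z ≤ tPt r ∧ ∀ n, N' * z ∉ setE r ε n))) ∨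
      ∃ n : ℕ, a = (n : ℤ) + 1 ∧ N' * z ∈ setE r ε n)
    (Set.Finite.countable (by simp)) ?_ ?_ ?_ ?_ ?_ ?_ ?_ ?_ ?_
  · intro a x hx
    have hx' : 0 < x := hx
    have : 0 < (2 : ℝ) ^ a * x := by positivity
    exact this
  · intro x hx
    rw [mem_Kre_iff] at hx
    show 0 < x
    rcases hx with ⟨h1, h2⟩ | ⟨n, h⟩ | h | h
    · have := h1.1
      nlinarith
    · exact (hJ n x h).1
    · linarith [h.1]
    · have := h.1
      nlinarith
  · intro x hx
    have hx' : 0 < x := hx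
    obtain ⟨n, hn⟩ := exists_mem_Ico_zpow (x := x / π) (y := (2 : ℝ)) (by positivity) (by norm_num)
    refine ⟨-n, ?_⟩
    have hp : (0 : ℝ) < 2 ^ n := by positivity
    obtain ⟨h1, h2⟩ := hn
    rw [le_div_iff₀ hpi] at h1
    rw [div_lt_iff₀ hpi, zpow_add₀ (by norm_num)] at h2
    have e : (2 : ℝ) ^ (-n) * x = x / 2 ^ n := by rw [zpow_neg]; field_simp
    simp only [e]
    constructor
    · rw [le_div_iff₀ hp]; linarith
    · rw [div_le_iff₀ hp]; norm_num at h2; linarith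
  · intro z w m hz hw hzB hwB h
    simp only [mem_insert_iff, mem_singleton_iff, not_or] at hzB hwB
    have z0 := lt_of_le_of_ne hz.1 (Ne.symm hzB.1)
    have z1 := lt_of_le_of_ne hz.2 hzB.2.2.2.2
    have w0 := lt_of_le_of_ne hw.1 (Ne.symm hwB.1)
    have w1 := lt_of_le_of_ne hw.2 hwB.2.2.2.2
    have h' : (2 : ℝ) ^ m * z = w := h
    rcases lt_trichotomy m 0 with hm | hm | hm
    · exfalso
      have : (2 : ℝ) ^ m ≤ 2 ^ (-1 : ℤ) := zpow_le_zpow_right₀ (by norm_num) (by omega)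
      norm_num at this
      nlinarith
    · exact hm
    · exfalso
      have : (2 : ℝ) ^ (1 : ℤ) ≤ 2 ^ m := zpow_le_zpow_right₀ (by norm_num) (by omega)
      norm_num at this
      nlinarith
  · rintro a z (⟨-, h1, h2⟩ | ⟨-, h1, h2⟩ | ⟨-, ⟨h1, h2⟩ | ⟨h1, h2, -⟩⟩ | ⟨n, -, h⟩)
    · constructor <;> linarith
    · constructor <;> linarith
    · constructor <;> linarith
    · constructor <;> linarith
    · obtain ⟨h1, h2⟩ := hJ' n z h
      constructor <;> linarith
  · intro z hz
    by_cases hU : ∃ n, N' * z ∈ setE r ε n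
    · obtain ⟨n, hn⟩ := hU
      exact ⟨_, Or.inr (Or.inr (Or.inr ⟨n, rfl, hn⟩))⟩
    by_cases hz1 : z ≤ tPt r
    · exact ⟨_, Or.inr (Or.inr (Or.inl ⟨rfl, Or.inr ⟨hz.1, hz1, not_exists.1 hU⟩⟩))⟩
    push Not at hz1
    by_cases hz2 : z ≤ tPt r + 2 * d
    · exact ⟨_, Or.inr (Or.inr (Or.inl ⟨rfl, Or.inl ⟨hz1.le, hz2⟩⟩))⟩
    push Not at hz2
    by_cases hz3 : z ≤ tPt r + 2 * ε
    · exact ⟨_, Or.inr (Or.inl ⟨rfl, hz2.le, hz3⟩)⟩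
    push Not at hz3
    exact ⟨0, Or.inl ⟨rfl, hz3.le, hz.2⟩⟩
  · intro a b z ha hb hzB
    simp only [mem_insert_iff, mem_singleton_iff, not_or] at hzB
    obtain ⟨b1, b2, b3, b4, b5⟩ := hzB
    rcases ha with ⟨rfl, h1, h2⟩ | ⟨rfl, h1, h2⟩ | ⟨rfl, ⟨h1, h2⟩ | ⟨h1, h2, h3⟩⟩ | ⟨n, rfl, h⟩ <;>
    rcases hb with ⟨rfl, k1, k2⟩ | ⟨rfl, k1, k2⟩ | ⟨rfl, ⟨k1, k2⟩ | ⟨k1, k2, k3⟩⟩ | ⟨m, rfl, k⟩ <;>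
    first
    | rfl
    | exact absurd h (k3 _)
    | exact absurd k (h3 _)
    | (rw [hdisj _ _ _ h k])
    | (exfalso
       try have h1 := (hJ' _ _ h).1
       try have h2 := (hJ' _ _ h).2
       try have k1 := (hJ' _ _ k).1
       try have k2 := (hJ' _ _ k).2
       first
       | linarith
       | exact b2 (by linarith)
       | exact b3 (by linarith)
       | exact b4 (by linarith))
  · intro x hx
    rw [mem_Kre_iff] at hx
    have e : N' * (N'⁻¹ * x) = x := mul_inv_cancel_left₀ hN0.ne' x
    rcases hx with ⟨⟨h1, h1'⟩, h2⟩ | ⟨n, h⟩ | h | ⟨h, h'⟩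
    · refine ⟨_, Or.inr (Or.inr (Or.inl ⟨rfl, Or.inr ?_⟩))⟩
      simp only [hzN', e]
      refine ⟨le_of_mul_le_mul_left ?_ hN0, le_of_mul_le_mul_left ?_ hN0, h2⟩ <;> linarith
    · cases n with
      | zero =>
        rw [mem_setE_zero] at h
        obtain ⟨h1, h2⟩ := h
        refine ⟨1, Or.inr (Or.inl ⟨rfl, ?_⟩)⟩
        simp only [zpow_one]
        constructor <;> linarith
      | succ n =>
        rw [mem_setE_succ, mem_setF_iff] at h
        refine ⟨_, Or.inr (Or.inr (Or.inr ⟨n, rfl, ?_⟩))⟩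
        simp only [hzn]
        convert h using 1
        rw [hN']; ring
    · exact ⟨0, Or.inl ⟨rfl, by simpa using h⟩⟩
    · refine ⟨_, Or.inr (Or.inr (Or.inl ⟨rfl, Or.inl ?_⟩))⟩
      simp only [hzN']
      refine ⟨le_of_mul_le_mul_left ?_ hN0, le_of_mul_le_mul_left ?_ hN0⟩
      · linarith
      · rw [e]; linarith
  · intro a z h
    rw [mem_Kre_iff]
    rcases h with ⟨rfl, h⟩ | ⟨rfl, h1, h2⟩ | ⟨rfl, h⟩ | ⟨n, rfl, h⟩
    · right; right; left
      simpa using h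
    · right; left
      refine ⟨0, (mem_setE_zero _ _ _).2 ?_⟩
      have e : (2 : ℝ) ^ (-1 : ℤ) * z = z / 2 := by norm_num; ring
      simp only [e]
      constructor <;> linarith
    · simp only [neg_neg, hzN]
      rcases h with ⟨h1, h2⟩ | ⟨h1, h2, h3⟩
      · right; right; right
        have := mul_le_mul_of_nonneg_left h1 hN0.le
        have := mul_le_mul_of_nonneg_left h2 hN0.le
        constructor <;> linarith
      · left
        have := mul_le_mul_of_nonneg_left h1 hN0.le
        have := mul_le_mul_of_nonneg_left h2 hN0.le
        exact ⟨⟨by linarith, by linarith⟩, h3⟩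
    · right; left
      refine ⟨n + 1, (mem_setE_succ _ _ _ _).2 ((mem_setF_iff _ _ _ _).2 ?_)⟩
      convert h using 1
      simp only [zpow_neg, hzn]
      rw [hN']
      field_simp
      ring

/-- For `r ≥ 1` and `0 < ε < (2^r - 1)π/(2^{r+1} - 1)`, the set
`K_{r,ε}` is an `H²`-wavelet set: its `2πℤ`-translates partition `ℝ` and its dyadic
dilates partition `(0,∞)`, up to null sets. -/
theorem Kre_is_h2_wavelet_set (r : ℕ) (hr : 1 ≤ r) (ε : ℝ)
    (hε0 : 0 < ε) (hε1 : ε < (2 ^ r - 1) * π / (2 ^ (r + 1) - 1)) :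
    PartitionUpToNull
      (fun k : ℤ => (fun x => x + 2 * (k : ℝ) * π) '' Kre r ε) Set.univ ∧
    PartitionUpToNull
      (fun j : ℤ => (fun x => (2 : ℝ) ^ j * x) '' Kre r ε) (Ioi 0) := by
  have g := good_of r hr ε hε0 hε1
  exact ⟨trans_part g, dil_part g⟩
end
end

section
/- Fix an integer r ≥ 1 and a real ε with 0 < ε < (2^r − 1)π/(2^{r+1} − 1). Then for every n ≥ 0, E_n ⊆ J_r and F_n ⊆ [2^{−(n+1)}π, 2^{−(n+1)}t_r]. -/
open MeasureTheory Set Filter Topology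
open scoped ENNReal Real

noncomputable section

/-- For every `n ≥ 0`, `Eₙ ⊆ J_r` and `Fₙ ⊆ [2^{-(n+1)}π, 2^{-(n+1)}t_r]`. -/
theorem setE_subset_Jr_and_setF_subset (r : ℕ) (hr : 1 ≤ r) (ε : ℝ)
    (hε0 : 0 < ε) (hε1 : ε < (2 ^ r - 1) * π / (2 ^ (r + 1) - 1)) :
    ∀ n : ℕ, setE r ε n ⊆ Jr r ∧
      setF r ε n ⊆ Icc (π / 2 ^ (n + 1)) (tPt r / 2 ^ (n + 1)) := by
  have hπ := Real.pi_pos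
  have hp : (1:ℝ) ≤ 2 ^ r := one_le_pow₀ (by norm_num)
  have hd : (0:ℝ) < 2 ^ (r + 1) - 1 := by rw [pow_succ]; linarith
  have ht : (2 ^ (r + 1) - 1) * tPt r = 2 ^ (r + 1) * π := by
    unfold tPt; field_simp
  have ht0 : 0 < tPt r := by unfold tPt; positivity
  have hεt : ε ≤ tPt r / 2 := by
    refine hε1.le.trans ?_
    rw [div_le_iff₀ hd]
    have : tPt r / 2 * (2 ^ (r + 1) - 1) = 2 ^ r * π := by
      rw [pow_succ] at *; linarith
    rw [this]; nlinarith
  have hF : ∀ n, setE r ε n ⊆ Jr r →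
      setF r ε n ⊆ Icc (π / 2 ^ (n + 1)) (tPt r / 2 ^ (n + 1)) := by
    rintro n h _ ⟨x, hx, rfl⟩
    obtain ⟨h1, h2⟩ := h hx
    have e : (2:ℝ) ^ (n + r + 2) = 2 ^ (n + 1) * 2 ^ (r + 1) := by ring
    have ha : (0:ℝ) < 2 ^ (n + 1) := by positivity
    have hb : (0:ℝ) < 2 ^ (r + 1) := by positivity
    simp only [e]
    constructor
    · calc π / 2 ^ (n + 1) = (2 ^ (n + 1) * 2 ^ (r + 1))⁻¹ * (2 ^ (r + 1) * π) := by field_simp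
        _ ≤ _ := by gcongr
    · calc _ ≤ (2 ^ (n + 1) * 2 ^ (r + 1))⁻¹ * (2 ^ (r + 1) * tPt r) := by gcongr
        _ = _ := by field_simp
  have hE : ∀ n, setE r ε n ⊆ Jr r := by
    intro n
    induction n with
    | zero =>
      rintro _ ⟨x, ⟨h1, h2⟩, rfl⟩
      have : 0 ≤ ε / 2 ^ (r + 1) := by positivity
      constructor <;> dsimp only <;> linarith
    | succ n ih =>
      rintro _ ⟨x, hx, rfl⟩
      obtain ⟨h1, h2⟩ := hF n ih hx
      have h3 : 0 < π / 2 ^ (n + 1) := by positivity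
      have h4 : tPt r / 2 ^ (n + 1) ≤ tPt r :=
        div_le_self ht0.le (one_le_pow₀ (by norm_num))
      constructor <;> dsimp only <;> linarith
  exact fun n => ⟨hE n, hF n (hE n)⟩
end
end

section
/- Fix an integer r ≥ 1 and a real ε with 0 < ε < (2^r − 1)π/(2^{r+1} − 1), and let K_{r,ε} = (J_r \ ⋃_{n≥0} E_n) ∪ (⋃_{n≥0} F_n) ∪ S₁ ∪ S₂ ∪ S₃. Then for every δ > 0, the Lebesgue measure of K_{r,ε} ∩ (0, δ) is positive; consequently, the characteristic function χ_{K_{r,ε}} does not vanish almost everywhere on any neighbourhood of the origin (and in particular is not almost everywhere equal to any function continuous at 0 with value 0 there). -/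
open MeasureTheory Set Filter Topology
open scoped ENNReal Real

noncomputable section

lemma setE_contains (r : ℕ) (ε : ℝ) (hε0 : 0 < ε) (n : ℕ) :
    ∃ u v : ℝ, 0 < u ∧ u < v ∧ v ≤ 2 * (2 ^ (r + 1) * π + (tPt r / 2 + ε)) ∧
      Icc u v ⊆ setE r ε n := by
  have hp : (1 : ℝ) < 2 ^ (r + 1) := one_lt_pow₀ (by norm_num) (by omega)
  have ha : 0 < (2 : ℝ) ^ (r + 1) * π := by positivity
  have ht : 0 < tPt r := div_pos ha (by linarith)
  induction n with
  | zero =>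
    have h1 : 0 < ε / 2 ^ (r + 1) := by positivity
    have h2 : ε / 2 ^ (r + 1) < ε := div_lt_self hε0 hp
    refine ⟨tPt r / 2 + ε / 2 ^ (r + 1) + 2 ^ (r + 1) * π, tPt r / 2 + ε + 2 ^ (r + 1) * π,
      by linarith, by linarith, by linarith, ?_⟩
    intro x hx
    exact ⟨x - 2 ^ (r + 1) * π, ⟨by linarith [hx.1], by linarith [hx.2]⟩, by simp⟩
  | succ n ih =>
    obtain ⟨u, v, hu, huv, hv, hs⟩ := ih
    have hP : (2 : ℝ) ≤ 2 ^ (n + r + 2) := by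
      calc (2 : ℝ) = 2 ^ 1 := by norm_num
        _ ≤ _ := pow_le_pow_right₀ (by norm_num) (by omega)
    have hP0 : (0 : ℝ) < 2 ^ (n + r + 2) := by positivity
    set P : ℝ := 2 ^ (n + r + 2) with hPd
    have hc : 0 < P⁻¹ := inv_pos.2 hP0
    have hc2 : P⁻¹ ≤ 1 / 2 := by
      rw [one_div]; exact inv_anti₀ (by norm_num) hP
    refine ⟨P⁻¹ * u + 2 ^ (r + 1) * π, P⁻¹ * v + 2 ^ (r + 1) * π, by positivity,
      by nlinarith, by nlinarith, ?_⟩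
    intro x hx
    refine ⟨x - 2 ^ (r + 1) * π, ⟨P * (x - 2 ^ (r + 1) * π), hs ⟨?_, ?_⟩, ?_⟩, by simp⟩
    · rw [← inv_mul_le_iff₀ hP0]; linarith [hx.1]
    · rw [← le_inv_mul_iff₀ hP0]; linarith [hx.2]
    · change P⁻¹ * _ = _
      field_simp

lemma Kre_pos (r : ℕ) (ε : ℝ) (hε0 : 0 < ε) (δ : ℝ) (hδ : 0 < δ) :
    0 < volume (Kre r ε ∩ Ioo 0 δ) := by
  set M := 2 * (2 ^ (r + 1) * π + (tPt r / 2 + ε)) with hM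
  obtain ⟨n, hn⟩ := pow_unbounded_of_one_lt (M / δ) (by norm_num : (1 : ℝ) < 2)
  obtain ⟨u, v, hu, huv, hv, hs⟩ := setE_contains r ε hε0 n
  have hP0 : (0 : ℝ) < 2 ^ (n + r + 2) := by positivity
  have hPn : (2 : ℝ) ^ n ≤ 2 ^ (n + r + 2) := pow_le_pow_right₀ (by norm_num) (by omega)
  have hsub : Icc (((2 : ℝ) ^ (n + r + 2))⁻¹ * u) (((2 : ℝ) ^ (n + r + 2))⁻¹ * v)
      ⊆ Kre r ε ∩ Ioo 0 δ := by
    intro x hx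
    constructor
    · refine Or.inl (Or.inl (Or.inl (Or.inr (mem_iUnion.2 ⟨n, ?_⟩))))
      refine ⟨2 ^ (n + r + 2) * x, hs ⟨?_, ?_⟩, ?_⟩
      · rw [← inv_mul_le_iff₀ hP0]; exact hx.1
      · rw [← le_inv_mul_iff₀ hP0]; exact hx.2
      · change (_ : ℝ)⁻¹ * _ = _
        field_simp
    · refine ⟨lt_of_lt_of_le (by positivity) hx.1, lt_of_le_of_lt hx.2 ?_⟩
      rw [inv_mul_lt_iff₀ hP0]
      rw [div_lt_iff₀ hδ] at hn
      nlinarith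
  refine lt_of_lt_of_le ?_ (measure_mono hsub)
  rw [Real.volume_Icc, ENNReal.ofReal_pos, sub_pos]
  exact mul_lt_mul_of_pos_left huv (inv_pos.2 hP0)

/-- Every interval `(0, δ)` meets `K_{r,ε}` in a set of positive
measure; consequently, `χ_{K_{r,ε}}` does not vanish a.e. on any neighbourhood of the
origin, and in particular it is not a.e. equal to any function that is continuous at `0`
and vanishes there. -/
theorem Kre_indicator_discontinuous_at_zero (r : ℕ) (hr : 1 ≤ r) (ε : ℝ)
    (hε0 : 0 < ε) (hε1 : ε < (2 ^ r - 1) * π / (2 ^ (r + 1) - 1)) :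
    (∀ δ : ℝ, 0 < δ → 0 < volume (Kre r ε ∩ Ioo 0 δ)) ∧
    (∀ U ∈ 𝓝 (0 : ℝ),
      ¬ (∀ᵐ ξ : ℝ, ξ ∈ U → Set.indicator (Kre r ε) (fun _ => (1 : ℝ)) ξ = 0)) ∧
    (∀ h : ℝ → ℝ, ContinuousAt h 0 → h 0 = 0 →
      ¬ (Set.indicator (Kre r ε) (fun _ => (1 : ℝ)) =ᵐ[volume] h)) := by
  have h2 : ∀ U ∈ 𝓝 (0 : ℝ),
      ¬ (∀ᵐ ξ : ℝ, ξ ∈ U → Set.indicator (Kre r ε) (fun _ => (1 : ℝ)) ξ = 0) := by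
    intro U hU hae
    obtain ⟨δ, hδ, hb⟩ := Metric.mem_nhds_iff.1 hU
    refine (Kre_pos r ε hε0 δ hδ).ne' (measure_mono_null ?_ (ae_iff.1 hae))
    rintro x ⟨hx, hx0, hx1⟩ hc
    have hxU : x ∈ U := hb (by
      rw [Metric.mem_ball, Real.dist_eq, sub_zero, abs_of_pos hx0]; exact hx1)
    have := hc hxU
    rw [indicator_of_mem hx] at this
    exact one_ne_zero this
  refine ⟨fun δ hδ => Kre_pos r ε hε0 δ hδ, h2, ?_⟩
  intro h hc h0 hae
  have hU : {x | h x < 1} ∈ 𝓝 (0 : ℝ) := hc (Iio_mem_nhds (by rw [h0]; norm_num))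
  refine h2 _ hU ?_
  filter_upwards [hae] with x hx hxU
  by_contra hne
  have hk : x ∈ Kre r ε := mem_of_indicator_ne_zero hne
  rw [indicator_of_mem hk] at hx
  have : h x < 1 := hxU
  linarith
end
end
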